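/- There exist a constant c > 0 and n₀ ∈ ℕ such that for every finite abelian group H of odd order with 5·|H| ≥ n₀, the group G = ℤ/5ℤ × H satisfies f_max(G) ≤ 2^{(1/2 − c)·μ(G)}; that is, f_max(G) is exponentially smaller than 2^{μ(G)/2}. -/

import Mathlib

/-- A subset `A` of an additive group is *sum-free* if there are no
`x, y, z ∈ A` (not necessarily distinct) with `x + y = z`. -/
def IsSumFree {G : Type*} [AddCommGroup G] (A : Set G) : Prop :=
  ∀ x ∈ A, ∀ y ∈ A, x + y ∉ A

/-- `A` is a maximal sum-free subset of `G`. -/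
def IsMaximalSumFree {G : Type*} [AddCommGroup G] (A : Set G) : Prop :=
  IsSumFree A ∧ ∀ B : Set G, IsSumFree B → A ⊆ B → A = B

/-- `μ(G)`: the maximum size of a sum-free subset of `G`. -/
noncomputable def sumFreeMu (G : Type*) [AddCommGroup G] [Fintype G] : ℕ :=
  sSup {k : ℕ | ∃ A : Set G, IsSumFree A ∧ A.ncard = k}

/-- `f_max(G)`: the number of maximal sum-free subsets of `G`. -/
noncomputable def fMaxSF (G : Type*) [AddCommGroup G] [Fintype G] : ℕ :=
  Nat.card {A : Set G // IsMaximalSumFree A}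

section

open Finset
open scoped Classical Pointwise

section Graph

variable {V : Type*}

/-- The maximal independent sets of the graph induced by `Γ` on `U`. -/
noncomputable def misSets (Γ : SimpleGraph V) (U : Finset V) : Finset (Finset V) :=
  {I ∈ U.powerset | (∀ x ∈ I, ∀ y ∈ I, ¬ Γ.Adj x y) ∧ ∀ x ∈ U, x ∉ I → ∃ y ∈ I, Γ.Adj x y}

/-- The neighbours of `v` inside `U`. -/
noncomputable def nbrsIn (Γ : SimpleGraph V) (U : Finset V) (v : V) : Finset V :=
  {u ∈ U | Γ.Adj v u}

/-- The closed neighbourhood of `v` inside `U`. -/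
noncomputable def closedNbrs (Γ : SimpleGraph V) (U : Finset V) (v : V) : Finset V :=
  insert v (nbrsIn Γ U v)

/-- The number of ordered pairs of adjacent vertices in `U`. -/
noncomputable def adjPairs (Γ : SimpleGraph V) (U : Finset V) : ℕ :=
  #{p ∈ U ×ˢ U | Γ.Adj p.1 p.2}

variable {Γ Γ' : SimpleGraph V} {U R : Finset V} {u v w : V}

lemma mem_misSets {I : Finset V} : I ∈ misSets Γ U ↔ I ⊆ U ∧
    (∀ x ∈ I, ∀ y ∈ I, ¬ Γ.Adj x y) ∧ ∀ x ∈ U, x ∉ I → ∃ y ∈ I, Γ.Adj x y := by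
  simp [misSets]

lemma mem_nbrsIn : u ∈ nbrsIn Γ U v ↔ u ∈ U ∧ Γ.Adj v u := by simp [nbrsIn]

lemma mem_closedNbrs : u ∈ closedNbrs Γ U v ↔ u = v ∨ u ∈ U ∧ Γ.Adj v u := by
  simp [closedNbrs, nbrsIn]

lemma closedNbrs_subset (hv : v ∈ U) : closedNbrs Γ U v ⊆ U := by
  intro u hu
  rcases mem_closedNbrs.1 hu with rfl | h
  exacts [hv, h.1]

lemma card_closedNbrs : #(closedNbrs Γ U v) = #(nbrsIn Γ U v) + 1 := by
  rw [closedNbrs, card_insert_of_notMem]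
  simp [mem_nbrsIn]

lemma nbrsIn_mono {W : Finset V} (h : W ⊆ U) : nbrsIn Γ W v ⊆ nbrsIn Γ U v :=
  filter_subset_filter _ h

lemma adjPairs_eq_sum : adjPairs Γ U = ∑ v ∈ U, #(nbrsIn Γ U v) := by
  rw [adjPairs, card_filter, sum_product]
  exact sum_congr rfl fun v _ ↦ by rw [nbrsIn, card_filter]

lemma adjPairs_le_sdiff {Δ : ℕ} (hR : R ⊆ U) (hΔ : ∀ v ∈ U, #(nbrsIn Γ U v) ≤ Δ) :
    adjPairs Γ U ≤ adjPairs Γ (U \ R) + 2 * Δ * #R := by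
  have h1 : ∑ v ∈ R, #(nbrsIn Γ U v) ≤ Δ * #R := by
    rw [mul_comm]; exact sum_le_card_nsmul _ _ _ fun v hv ↦ hΔ v (hR hv)
  have h2 : ({p ∈ U ×ˢ U | Γ.Adj p.1 p.2} : Finset (V × V)) ⊆
      {p ∈ (U \ R) ×ˢ (U \ R) | Γ.Adj p.1 p.2} ∪
      ({p ∈ R ×ˢ U | Γ.Adj p.1 p.2} ∪ {p ∈ U ×ˢ R | Γ.Adj p.1 p.2}) := by
    intro p
    simp only [mem_union, mem_filter, mem_product, mem_sdiff]
    tauto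
  have h3 : #{p ∈ R ×ˢ U | Γ.Adj p.1 p.2} = ∑ v ∈ R, #(nbrsIn Γ U v) := by
    rw [card_filter, sum_product]
    exact sum_congr rfl fun v _ ↦ by rw [nbrsIn, card_filter]
  have h4 : #{p ∈ U ×ˢ R | Γ.Adj p.1 p.2} = ∑ v ∈ R, #(nbrsIn Γ U v) := by
    rw [card_filter, sum_product_right]
    exact sum_congr rfl fun v _ ↦ by simp only [nbrsIn, card_filter, Γ.adj_comm v]
  have := (card_le_card h2).trans (card_union_le _ _)
  have := card_union_le ({p ∈ R ×ˢ U | Γ.Adj p.1 p.2}) ({p ∈ U ×ˢ R | Γ.Adj p.1 p.2})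
  simp only [adjPairs]
  nlinarith

lemma card_misSets_filter_mem_le (v : V) :
    #{I ∈ misSets Γ U | v ∈ I} ≤ #(misSets Γ (U \ closedNbrs Γ U v)) := by
  refine card_le_card_of_injOn (fun I ↦ I.erase v) ?_ ?_
  · intro I hI
    simp only [coe_filter, Set.mem_ofPred_eq, mem_misSets] at hI
    obtain ⟨⟨hIU, hind, hmax⟩, hv⟩ := hI
    simp only [mem_coe, mem_misSets]
    refine ⟨fun x hx ↦ ?_, fun x hx y hy ↦ ?_, fun x hx hxI ↦ ?_⟩
    · rw [mem_erase] at hx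
      simp only [mem_sdiff, mem_closedNbrs, not_or, not_and]
      exact ⟨hIU hx.2, hx.1, fun _ ↦ hind v hv x hx.2⟩
    · exact hind x (mem_of_mem_erase hx) y (mem_of_mem_erase hy)
    · simp only [mem_sdiff, mem_closedNbrs, not_or, not_and] at hx
      obtain ⟨y, hy, hxy⟩ := hmax x hx.1 (fun h ↦ hxI (mem_erase.2 ⟨hx.2.1, h⟩))
      refine ⟨y, mem_erase.2 ⟨?_, hy⟩, hxy⟩
      rintro rfl
      exact hx.2.2 hx.1 hxy.symm
  · intro I hI J hJ h
    simp only [coe_filter, Set.mem_ofPred_eq] at hI hJ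
    rw [← insert_erase hI.2, ← insert_erase hJ.2]
    exact congrArg (insert v) h

lemma card_misSets_le_branch (v : V) :
    #(misSets Γ U) ≤ #(misSets Γ (U.erase v)) + #(misSets Γ (U \ closedNbrs Γ U v)) := by
  rw [← card_filter_add_card_filter_not (s := misSets Γ U) (fun I ↦ v ∈ I), add_comm]
  refine Nat.add_le_add (card_le_card fun I hI ↦ ?_) (card_misSets_filter_mem_le v)
  simp only [mem_filter, mem_misSets] at hI ⊢
  obtain ⟨⟨hIU, hind, hmax⟩, hv⟩ := hI
  exact ⟨fun x hx ↦ mem_erase.2 ⟨fun h ↦ hv (h ▸ hx), hIU hx⟩, hind,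
    fun x hx ↦ hmax x (mem_of_mem_erase hx)⟩

lemma card_misSets_le_sum (hv : v ∈ U) :
    #(misSets Γ U) ≤ ∑ u ∈ closedNbrs Γ U v, #(misSets Γ (U \ closedNbrs Γ U u)) := by
  calc #(misSets Γ U)
      ≤ #((closedNbrs Γ U v).biUnion fun u ↦ {I ∈ misSets Γ U | u ∈ I}) := by
        refine card_le_card fun I hI ↦ ?_
        simp only [mem_biUnion, mem_filter]
        by_cases hvI : v ∈ I
        · exact ⟨v, by simp [closedNbrs], hI, hvI⟩
        · have hI' := mem_misSets.1 hI
          obtain ⟨y, hy, hvy⟩ := hI'.2.2 v hv hvI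
          exact ⟨y, mem_closedNbrs.2 (.inr ⟨hI'.1 hy, hvy⟩), hI, hy⟩
    _ ≤ ∑ u ∈ closedNbrs Γ U v, #{I ∈ misSets Γ U | u ∈ I} := card_biUnion_le
    _ ≤ _ := sum_le_sum fun u _ ↦ card_misSets_filter_mem_le u

lemma card_misSets_empty : #(misSets Γ ∅) = 1 := by
  rw [card_eq_one]
  exact ⟨∅, by ext I; simp +contextual [mem_misSets]⟩

lemma succ_cube_le_three_pow (d : ℕ) : (d + 1) ^ 3 ≤ 3 ^ (d + 1) := by
  rcases Nat.lt_or_ge d 2 with h | h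
  · interval_cases d <;> norm_num
  induction d, h using Nat.le_induction with
  | base => norm_num
  | succ d hd ih =>
    rw [pow_succ 3 (d + 1)]
    nlinarith [mul_le_mul hd hd (by norm_num) (by omega), pow_succ d 2, sq_nonneg (d : ℤ)]

/-- The Moon–Moser bound. -/
theorem card_misSets_le_pow {r : ℝ} (hr : 1 ≤ r) (hr3 : 3 ≤ r ^ 3) (U : Finset V) :
    (#(misSets Γ U) : ℝ) ≤ r ^ #U := by
  induction U using Finset.strongInduction with
  | H U ih =>
  rcases U.eq_empty_or_nonempty with rfl | hU
  · simp [card_misSets_empty]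
  obtain ⟨v, hv, hmin⟩ := exists_min_image U (fun v ↦ #(nbrsIn Γ U v)) hU
  set d := #(nbrsIn Γ U v) with hd
  have hle : d + 1 ≤ #U := by
    rw [hd, ← card_closedNbrs]; exact card_le_card (closedNbrs_subset hv)
  have hdr : ((d : ℝ) + 1) ≤ r ^ (d + 1) := by
    have h3 : (((d : ℝ) + 1)) ^ 3 ≤ (r ^ (d + 1)) ^ 3 := by
      calc ((d : ℝ) + 1) ^ 3 ≤ 3 ^ (d + 1) := by exact_mod_cast succ_cube_le_three_pow d
        _ ≤ (r ^ 3) ^ (d + 1) := by gcongr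
        _ = _ := by ring
    exact le_of_pow_le_pow_left₀ (by norm_num) (by positivity) h3
  calc (#(misSets Γ U) : ℝ)
      ≤ ∑ u ∈ closedNbrs Γ U v, (#(misSets Γ (U \ closedNbrs Γ U u)) : ℝ) := by
        exact_mod_cast card_misSets_le_sum hv
    _ ≤ ∑ u ∈ closedNbrs Γ U v, r ^ (#U - (d + 1)) := by
        refine sum_le_sum fun u hu ↦ ?_
        have huU := closedNbrs_subset hv hu
        have hsub := closedNbrs_subset (Γ := Γ) huU
        refine (ih _ (sdiff_ssubset hsub ⟨u, by simp [closedNbrs]⟩)).trans ?_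
        refine pow_le_pow_right₀ hr ?_
        rw [card_sdiff_of_subset hsub, card_closedNbrs]
        have := hmin u huU
        omega
    _ = (d + 1) * r ^ (#U - (d + 1)) := by
        rw [sum_const, card_closedNbrs, nsmul_eq_mul, hd]; push_cast; ring
    _ ≤ r ^ (d + 1) * r ^ (#U - (d + 1)) := by gcongr
    _ = r ^ #U := by rw [← pow_add]; congr 1; omega

end Graph

section Measure

variable {V : Type*} {Γ Γ' : SimpleGraph V} {U R : Finset V} {u v w : V}

lemma mem_closedNbrs_self : v ∈ closedNbrs Γ U v := mem_insert_self _ _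

lemma nbrsIn_mono_graph (h : Γ' ≤ Γ) : nbrsIn Γ' U v ⊆ nbrsIn Γ U v := fun x hx ↦ by
  rw [mem_nbrsIn] at hx ⊢
  exact ⟨hx.1, h hx.2⟩

/-- Deleting `D` costs at most a factor `2 ^ #D` in the number of maximal independent sets. -/
lemma card_misSets_le_of_sdiff {M : ℝ} (D : Finset V) :
    ∀ U : Finset V, (∀ W ⊆ U \ D, (#(misSets Γ W) : ℝ) ≤ M) →
      (#(misSets Γ U) : ℝ) ≤ 2 ^ #D * M := by
  induction D using Finset.induction_on with
  | empty => intro U h; simpa using h U (by simp)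
  | insert a D ha ih =>
    intro U h
    have h1 := ih (U.erase a) fun W hW ↦ h W fun x hx ↦ by
      have := hW hx; simp only [mem_sdiff, mem_erase, mem_insert] at this ⊢; tauto
    have h2 := ih (U \ closedNbrs Γ U a) fun W hW ↦ h W fun x hx ↦ by
      have := hW hx; simp only [mem_sdiff, mem_closedNbrs, mem_insert] at this ⊢; tauto
    have h3 : (#(misSets Γ U) : ℝ) ≤ #(misSets Γ (U.erase a)) +
      #(misSets Γ (U \ closedNbrs Γ U a)) := by exact_mod_cast card_misSets_le_branch a
    rw [card_insert_of_notMem ha, pow_succ]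
    linarith

lemma adjPairs_eq_of_no_edge (hR : R ⊆ U) (h : ∀ x ∈ R, ∀ y ∈ U \ R, ¬ Γ.Adj x y) :
    adjPairs Γ U = adjPairs Γ (U \ R) + ∑ v ∈ R, #(nbrsIn Γ U v) := by
  rw [adjPairs_eq_sum, adjPairs_eq_sum, ← sum_sdiff hR]
  congr 1
  refine sum_congr rfl fun v hv ↦ ?_
  congr 1
  ext x
  simp only [mem_nbrsIn, mem_sdiff]
  constructor
  · rintro ⟨hx, hvx⟩
    exact ⟨⟨hx, fun hxR ↦ h x hxR v hv hvx.symm⟩, hvx⟩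
  · tauto

/-- The measure used to analyse the branching on vertices. -/
noncomputable def branchMeasure (Γ : SimpleGraph V) (α β : ℝ) (U : Finset V) : ℝ :=
  α * #U - β * adjPairs Γ U

lemma branchMeasure_sdiff_le {α β z k : ℝ} {Δ : ℕ} (hβ : 0 ≤ β) (hz : 0 ≤ z)
    (hzα : z ≤ α - 2 * Δ * β) (hR : R ⊆ U) (hΔ : ∀ v ∈ U, #(nbrsIn Γ U v) ≤ Δ) (hk : k ≤ #R) :
    branchMeasure Γ α β (U \ R) ≤ branchMeasure Γ α β U - z * k := by
  have h1 : (adjPairs Γ U : ℝ) ≤ adjPairs Γ (U \ R) + 2 * Δ * #R := by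
    exact_mod_cast adjPairs_le_sdiff hR hΔ
  have h2 : (#(U \ R) : ℝ) = #U - #R := by
    rw [card_sdiff_of_subset hR, Nat.cast_sub (card_le_card hR)]
  have h3 : β * adjPairs Γ U ≤ β * (adjPairs Γ (U \ R) + 2 * Δ * #R) := by gcongr
  have h4 : z * k ≤ z * #R := by gcongr
  have h5 : z * #R ≤ (α - 2 * Δ * β) * #R := by gcongr
  simp only [branchMeasure, h2]
  linarith

lemma two_rpow_add_le {m a b x y : ℝ} (ha : x ≤ m - a) (hb : y ≤ m - b)
    (h : (2 : ℝ) ^ (-a) + 2 ^ (-b) ≤ 1) : (2 : ℝ) ^ x + 2 ^ y ≤ 2 ^ m := by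
  have h1 : (2 : ℝ) ^ x ≤ 2 ^ m * 2 ^ (-a) := by
    rw [← Real.rpow_add two_pos]; exact Real.rpow_le_rpow_of_exponent_le one_le_two (by linarith)
  have h2 : (2 : ℝ) ^ y ≤ 2 ^ m * 2 ^ (-b) := by
    rw [← Real.rpow_add two_pos]; exact Real.rpow_le_rpow_of_exponent_le one_le_two (by linarith)
  nlinarith [Real.rpow_pos_of_pos (two_pos (α := ℝ)) m]

lemma two_rpow_neg_le {p q : ℕ} {y : ℝ} (hy : 0 ≤ y) (hq : q ≠ 0) (h : 1 ≤ y ^ q * 2 ^ p) :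
    (2 : ℝ) ^ (-((p : ℝ) / q)) ≤ y := by
  refine le_of_pow_le_pow_left₀ hq hy ?_
  rw [← Real.rpow_natCast (2 ^ (-((p : ℝ) / q))), ← Real.rpow_mul two_pos.le]
  have : -((p : ℝ) / q) * q = -p := by field_simp
  rw [this, Real.rpow_neg two_pos.le, Real.rpow_natCast]
  rw [inv_le_iff_one_le_mul₀ (by positivity)]
  exact h

lemma two_rpow_neg_mul {z : ℝ} (k : ℕ) : (2 : ℝ) ^ (-(z * k)) = (2 ^ (-z)) ^ k := by
  rw [← Real.rpow_natCast, ← Real.rpow_mul two_pos.le, neg_mul]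

/-- Branching over a vertex of degree at least `d` in a graph of maximum degree at most `Δ`. -/
lemma card_misSets_le_of_branch {α β z : ℝ} {Δ d : ℕ} (hΓ : Γ' ≤ Γ) (hβ : 0 ≤ β) (hz : 0 ≤ z)
    (hzα : z ≤ α - 2 * Δ * β) (hΔ : ∀ v ∈ U, #(nbrsIn Γ' U v) ≤ Δ) (hv : v ∈ U)
    (hd : d ≤ #(nbrsIn Γ' U v)) (h : (2 : ℝ) ^ (-z) + (2 ^ (-z)) ^ (d + 1) ≤ 1)
    (ih : ∀ W ⊂ U, (#(misSets Γ W) : ℝ) ≤ 2 ^ branchMeasure Γ' α β W) :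
    (#(misSets Γ U) : ℝ) ≤ 2 ^ branchMeasure Γ' α β U := by
  have h0 : (#(misSets Γ U) : ℝ) ≤ #(misSets Γ (U.erase v)) +
    #(misSets Γ (U \ closedNbrs Γ U v)) := by exact_mod_cast card_misSets_le_branch v
  have h1 := ih _ (erase_ssubset hv)
  have h2 := ih _ (sdiff_ssubset (closedNbrs_subset (Γ := Γ) hv) ⟨v, mem_closedNbrs_self⟩)
  refine h0.trans ((add_le_add h1 h2).trans ?_)
  refine two_rpow_add_le (a := z) (b := z * (d + 1 : ℕ)) ?_ ?_ ?_
  · have := branchMeasure_sdiff_le (k := 1) hβ hz hzα (singleton_subset_iff.2 hv) hΔ (by simp)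
    rwa [mul_one, sdiff_singleton_eq_erase] at this
  · refine branchMeasure_sdiff_le hβ hz hzα (closedNbrs_subset hv) hΔ ?_
    rw [card_closedNbrs, Nat.cast_le]
    have := card_le_card (nbrsIn_mono_graph hΓ (U := U) (v := v))
    omega
  · rwa [two_rpow_neg_mul]

lemma two_rpow_neg_anti {z z' y : ℝ} (h : (2 : ℝ) ^ (-z') ≤ y) (hz : z' ≤ z) :
    (2 : ℝ) ^ (-z) ≤ y :=
  (Real.rpow_le_rpow_of_exponent_le one_le_two (by linarith)).trans h

lemma two_rpow_three_sevenths : (2 : ℝ) ^ (-(3 / 7 : ℝ)) ≤ 0.75 := by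
  simpa using two_rpow_neg_le (p := 3) (q := 7) (y := 0.75) (by norm_num) (by norm_num)
    (by norm_num)

lemma two_rpow_seven_fifteenths : (2 : ℝ) ^ (-(7 / 15 : ℝ)) ≤ 0.7237 := by
  simpa using two_rpow_neg_le (p := 7) (q := 15) (y := 0.7237) (by norm_num) (by norm_num)
    (by norm_num)

lemma two_rpow_49 : (2 : ℝ) ^ (-(49 / 100 : ℝ)) ≤ 0.715 := by
  simpa using two_rpow_neg_le (p := 49) (q := 100) (y := 0.715) (by norm_num) (by norm_num)
    (by norm_num)

lemma card_misSets_le_two_rpow (U : Finset V) :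
    (#(misSets Γ U) : ℝ) ≤ 2 ^ (0.5285 * #U : ℝ) := by
  rw [Real.rpow_mul_natCast two_pos.le]
  have h : (2 : ℝ) ^ (-0.5285 : ℝ) ≤ 0.6933 := by
    refine two_rpow_neg_anti ?_ (by norm_num : (65 / 123 : ℝ) ≤ 0.5285)
    simpa using two_rpow_neg_le (p := 65) (q := 123) (y := 0.6933) (by norm_num) (by norm_num)
      (by norm_num)
  refine card_misSets_le_pow (Real.one_le_rpow one_le_two (by norm_num)) ?_ U
  have h0 : (0 : ℝ) < 2 ^ (-0.5285 : ℝ) := by positivity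
  have h1 : (2 : ℝ) ^ (0.5285 : ℝ) = (2 ^ (-0.5285 : ℝ))⁻¹ := by
    rw [← Real.rpow_neg two_pos.le]; norm_num
  rw [h1]
  calc (3 : ℝ) ≤ (0.6933⁻¹) ^ 3 := by norm_num
    _ ≤ _ := by gcongr

/-- A bound for the number of maximal independent sets in a graph that has a spanning subgraph
of maximum degree at most four with many edges. -/
theorem card_misSets_le_of_degree_le_four (hΓ : Γ' ≤ Γ) (U : Finset V)
    (hΔ : ∀ v ∈ U, #(nbrsIn Γ' U v) ≤ 4) :
    (#(misSets Γ U) : ℝ) ≤ 2 ^ branchMeasure Γ' 0.5585 0.015 U := by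
  induction U using Finset.strongInduction with
  | H U ih =>
  replace ih : ∀ W ⊂ U, (#(misSets Γ W) : ℝ) ≤ 2 ^ branchMeasure Γ' 0.5585 0.015 W :=
    fun W hW ↦ ih W hW fun v hv ↦ (card_le_card (nbrsIn_mono hW.1)).trans (hΔ v (hW.1 hv))
  by_cases h4 : ∃ v ∈ U, 4 ≤ #(nbrsIn Γ' U v)
  · obtain ⟨v, hv, hd⟩ := h4
    refine card_misSets_le_of_branch (z := 3 / 7) hΓ (by norm_num) (by norm_num) (by norm_num)
      hΔ hv hd ?_ ih
    have h := two_rpow_three_sevenths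
    calc _ ≤ (0.75 : ℝ) + 0.75 ^ (4 + 1) := by gcongr
      _ ≤ 1 := by norm_num
  push Not at h4
  by_cases h3 : ∃ v ∈ U, 3 ≤ #(nbrsIn Γ' U v)
  · obtain ⟨v, hv, hd⟩ := h3
    refine card_misSets_le_of_branch (z := 7 / 15) (Δ := 3) hΓ (by norm_num) (by norm_num)
      (by norm_num) (fun v hv ↦ by have := h4 v hv; omega) hv hd ?_ ih
    have h := two_rpow_seven_fifteenths
    calc _ ≤ (0.7237 : ℝ) + 0.7237 ^ (3 + 1) := by gcongr
      _ ≤ 1 := by norm_num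
  push Not at h3
  have hE : (adjPairs Γ' U : ℝ) ≤ 2 * #U := by
    rw [adjPairs_eq_sum]
    have := sum_le_card_nsmul U (fun v ↦ #(nbrsIn Γ' U v)) 2
      fun v hv ↦ by have := h3 v hv; omega
    rw [smul_eq_mul, mul_comm] at this
    exact_mod_cast this
  refine (card_misSets_le_two_rpow U).trans (Real.rpow_le_rpow_of_exponent_le one_le_two ?_)
  rw [branchMeasure]
  have : (0 : ℝ) ≤ #U := by positivity
  linarith

/-- A bound for the number of maximal independent sets in a triangle-free graph of bounded
degree with many edges. -/
theorem card_misSets_le_of_triangle_free (U : Finset V)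
    (hΔ : ∀ v ∈ U, #(nbrsIn Γ U v) ≤ 18)
    (htf : ∀ x ∈ U, ∀ y ∈ U, ∀ z ∈ U, Γ.Adj x y → Γ.Adj y z → ¬ Γ.Adj x z) :
    (#(misSets Γ U) : ℝ) ≤ 2 ^ branchMeasure Γ 0.5005 0.0005 U := by
  induction U using Finset.strongInduction with
  | H U ih =>
  replace ih : ∀ W ⊂ U, (#(misSets Γ W) : ℝ) ≤ 2 ^ branchMeasure Γ 0.5005 0.0005 W :=
    fun W hW ↦ ih W hW (fun v hv ↦ (card_le_card (nbrsIn_mono hW.1)).trans (hΔ v (hW.1 hv)))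
      fun x hx y hy z hz ↦ htf x (hW.1 hx) y (hW.1 hy) z (hW.1 hz)
  by_cases h3 : ∃ v ∈ U, 3 ≤ #(nbrsIn Γ U v)
  · obtain ⟨v, hv, hd⟩ := h3
    refine card_misSets_le_of_branch (z := 7 / 15) (Δ := 18) le_rfl (by norm_num) (by norm_num)
      (by norm_num) hΔ hv hd ?_ ih
    have h := two_rpow_seven_fifteenths
    calc _ ≤ (0.7237 : ℝ) + 0.7237 ^ (3 + 1) := by gcongr
      _ ≤ 1 := by norm_num
  push Not at h3
  have h2 : ∀ v ∈ U, #(nbrsIn Γ U v) ≤ 2 := fun v hv ↦ by have := h3 v hv; omega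
  have drop : ∀ (R : Finset V) (k : ℕ), R ⊆ U → R.Nonempty → k ≤ #R →
      (#(misSets Γ (U \ R)) : ℝ) ≤
        2 ^ (branchMeasure Γ 0.5005 0.0005 U - (49 / 100 : ℝ) * k) := fun R k hR hne hk ↦
    (ih _ (sdiff_ssubset hR hne)).trans (Real.rpow_le_rpow_of_exponent_le one_le_two
      (branchMeasure_sdiff_le (Δ := 2) (by norm_num) (by norm_num) (by norm_num) hR h2
        (by exact_mod_cast hk)))
  have key := two_rpow_49
  set m := branchMeasure Γ 0.5005 0.0005 U with hm
  rcases U.eq_empty_or_nonempty with rfl | hU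
  · simp [card_misSets_empty, hm, branchMeasure, adjPairs]
  by_cases h0 : ∃ v ∈ U, #(nbrsIn Γ U v) = 0
  · obtain ⟨v, hv, hd⟩ := h0
    have hc : closedNbrs Γ U v = {v} := by rw [closedNbrs, card_eq_zero.1 hd]; rfl
    have hT : #(misSets Γ U) ≤ #(misSets Γ (U \ {v})) := by
      have := card_misSets_le_sum (Γ := Γ) hv
      rwa [hc, sum_singleton, hc] at this
    refine (Nat.cast_le.2 hT).trans ((drop {v} 0 (by simpa) (by simp) (by simp)).trans ?_)
    simp
  push Not at h0
  by_cases h1 : ∃ v ∈ U, #(nbrsIn Γ U v) = 1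
  · obtain ⟨v, hv, hd⟩ := h1
    obtain ⟨u, hu⟩ := card_eq_one.1 hd
    have huv : u ∈ U ∧ Γ.Adj v u := mem_nbrsIn.1 (hu ▸ mem_singleton_self u)
    have hc : closedNbrs Γ U v = {v, u} := by rw [closedNbrs, hu]
    have hT : (#(misSets Γ U) : ℝ) ≤ #(misSets Γ (U \ {v, u})) +
        #(misSets Γ (U \ closedNbrs Γ U u)) := by
      have := card_misSets_le_sum (Γ := Γ) hv
      rw [hc, sum_pair huv.2.ne, hc] at this
      exact_mod_cast this
    have hsub : ({v, u} : Finset V) ⊆ U := hc ▸ closedNbrs_subset hv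
    by_cases hdu : #(nbrsIn Γ U u) = 1
    · obtain ⟨w, hw⟩ := card_eq_one.1 hdu
      obtain rfl : v = w := by
        have : v ∈ nbrsIn Γ U u := mem_nbrsIn.2 ⟨hv, huv.2.symm⟩
        rwa [hw, mem_singleton] at this
      have hc' : closedNbrs Γ U u = {v, u} := by rw [closedNbrs, hw, pair_comm]
      have hE : adjPairs Γ U = adjPairs Γ (U \ {v, u}) + 2 := by
        rw [adjPairs_eq_of_no_edge hsub, sum_pair huv.2.ne, hd, hdu]
        intro x hx y hy hxy
        rw [mem_sdiff] at hy
        have h : y ∈ closedNbrs Γ U x := mem_closedNbrs.2 (.inr ⟨hy.1, hxy⟩)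
        rcases mem_insert.1 hx with rfl | hx
        · exact hy.2 (hc ▸ h)
        · rw [mem_singleton.1 hx] at h; exact hy.2 (hc' ▸ h)
      have hcard : (#(U \ {v, u}) : ℝ) = #U - 2 := by
        rw [card_sdiff_of_subset hsub, Nat.cast_sub (card_le_card hsub), card_pair huv.2.ne]
        norm_num
      rw [hc'] at hT
      have hI := ih _ (sdiff_ssubset hsub ⟨v, mem_insert_self _ _⟩)
      have hme : branchMeasure Γ 0.5005 0.0005 (U \ {v, u}) = m - 1 := by
        rw [hm, branchMeasure, branchMeasure, hE, hcard]; push_cast; ring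
      rw [hme, Real.rpow_sub two_pos, Real.rpow_one] at hI
      linarith
    · have hdu2 : #(nbrsIn Γ U u) = 2 := by
        have := h0 u huv.1; have := h2 u huv.1; omega
      have hA := drop {v, u} 2 hsub (by simp) (card_pair huv.2.ne).ge
      have hB := drop (closedNbrs Γ U u) 3 (closedNbrs_subset huv.1) ⟨u, mem_closedNbrs_self⟩
        (by rw [card_closedNbrs, hdu2])
      refine hT.trans ((add_le_add hA hB).trans (two_rpow_add_le le_rfl le_rfl ?_))
      rw [two_rpow_neg_mul, two_rpow_neg_mul]
      calc _ ≤ (0.715 : ℝ) ^ 2 + 0.715 ^ 3 := by gcongr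
        _ ≤ 1 := by norm_num
  push Not at h1
  have hdeg : ∀ v ∈ U, #(nbrsIn Γ U v) = 2 := fun v hv ↦ by
    have := h0 v hv; have := h1 v hv; have := h2 v hv; omega
  obtain ⟨v, hv⟩ := hU
  obtain ⟨u, hu⟩ := card_pos.1 (by rw [hdeg v hv]; norm_num : 0 < #(nbrsIn Γ U v))
  rw [mem_nbrsIn] at hu
  have hvu : v ∈ nbrsIn Γ U u := mem_nbrsIn.2 ⟨hv, hu.2.symm⟩
  have hnW : ∀ x, nbrsIn Γ (U.erase v) x = (nbrsIn Γ U x).erase v := fun x ↦ by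
    ext y; simp only [mem_nbrsIn, mem_erase]; tauto
  obtain ⟨w, hw⟩ := card_eq_one.1 (by
    rw [hnW, card_erase_of_mem hvu, hdeg u hu.1] : #(nbrsIn Γ (U.erase v) u) = 1)
  have huw : w ∈ U.erase v ∧ Γ.Adj u w := mem_nbrsIn.1 (hw ▸ mem_singleton_self w)
  have hwU := mem_of_mem_erase huw.1
  have huW : u ∈ U.erase v := mem_erase.2 ⟨hu.2.ne', hu.1⟩
  have hwv : v ∉ nbrsIn Γ U w := fun h ↦
    htf v hv u hu.1 w hwU hu.2 huw.2 (mem_nbrsIn.1 h).2.symm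
  have hc : closedNbrs Γ (U.erase v) u = {u, w} := by rw [closedNbrs, hw]
  have hT1 : (#(misSets Γ U) : ℝ) ≤ #(misSets Γ (U.erase v)) +
    #(misSets Γ (U \ closedNbrs Γ U v)) := by exact_mod_cast card_misSets_le_branch v
  have hT2 : (#(misSets Γ (U.erase v)) : ℝ) ≤ #(misSets Γ (U.erase v \ {u, w})) +
        #(misSets Γ (U.erase v \ closedNbrs Γ (U.erase v) w)) := by
    have := card_misSets_le_sum (Γ := Γ) huW
    rw [hc, sum_pair huw.2.ne, hc] at this
    exact_mod_cast this
  have he : ∀ R : Finset V, U.erase v \ R = U \ insert v R := fun R ↦ by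
    ext x; simp only [mem_sdiff, mem_erase, mem_insert]; tauto
  rw [he, he] at hT2
  have hA := drop (closedNbrs Γ U v) 3 (closedNbrs_subset hv) ⟨v, mem_closedNbrs_self⟩
        (by rw [card_closedNbrs, hdeg v hv])
  have hB := drop (insert v {u, w}) 3 (by
    intro x hx; simp only [mem_insert, mem_singleton] at hx
    rcases hx with rfl | rfl | rfl
    exacts [hv, hu.1, hwU]) (by simp) (by
      rw [card_insert_of_notMem, card_pair huw.2.ne]
      simp only [mem_insert, mem_singleton, not_or]
      exact ⟨hu.2.ne, (ne_of_mem_erase huw.1).symm⟩)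
  have hC := drop (insert v (closedNbrs Γ (U.erase v) w)) 4 (by
    intro x hx
    rcases mem_insert.1 hx with rfl | hx
    exacts [hv, mem_of_mem_erase (closedNbrs_subset huw.1 hx)]) (by simp) (by
      rw [card_insert_of_notMem, card_closedNbrs, hnW, erase_eq_of_notMem hwv, hdeg w hwU]
      exact fun h ↦ notMem_erase v U (closedNbrs_subset huw.1 h))
  have h0 : ∀ k : ℕ, (2 : ℝ) ^ (m - 49 / 100 * k) ≤ 2 ^ m * 0.715 ^ k := fun k ↦ by
    rw [sub_eq_add_neg, Real.rpow_add two_pos, two_rpow_neg_mul]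
    gcongr
  have h3 := h0 3
  have h4 := h0 4
  have : (0 : ℝ) < 2 ^ m := by positivity
  linarith

end Measure

section Link

variable {G : Type*} [AddCommGroup G] {A B C S S' : Finset G} {x y s : G}

/-- The link graph of `S`: the pairs that form a Schur triple with an element of `S`. -/
def linkGraph (S : Finset G) : SimpleGraph G where
  Adj x y := x ≠ y ∧ ∃ s ∈ S, x + y = s ∨ x + s = y ∨ y + s = x
  symm := ⟨fun x y ⟨h, s, hs, h'⟩ ↦ ⟨h.symm, s, hs, by rw [add_comm y x]; tauto⟩⟩
  loopless := ⟨fun _ h ↦ h.1 rfl⟩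

/-- The elements that form a Schur triple with elements of `S` without help from others. -/
def linkLoops (S : Finset G) : Set G :=
  {x | x + x ∈ S ∨ ∃ s ∈ S, ∃ t ∈ S, x + s = t ∨ s + t = x}

lemma IsSumFree.subset {A B : Set G} (hB : IsSumFree B) (h : A ⊆ B) : IsSumFree A :=
  fun x hx y hy hxy ↦ hB x (h hx) y (h hy) (h hxy)

lemma IsSumFree.zero_notMem {A : Set G} (hA : IsSumFree A) : (0 : G) ∉ A := fun h ↦
  hA 0 h 0 h (by simpa)

/-- A maximal sum-free set restricts to a maximal independent set of the link graph. -/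
lemma inter_mem_misSets (hA : IsMaximalSumFree (A : Set G)) (hABC : A ⊆ B ∪ C)
    (hB : IsSumFree (B : Set G)) :
    A ∩ B ∈ misSets (linkGraph (A ∩ C)) {x ∈ B | x ∉ linkLoops (A ∩ C)} := by
  have hsf := hA.1
  simp only [IsSumFree, mem_coe] at hsf hB
  have h0 : (0 : G) ∉ A := fun h ↦ hsf 0 h 0 h (by simpa)
  have h0B : (0 : G) ∉ B := fun h ↦ hB 0 h 0 h (by simpa)
  rw [mem_misSets]
  refine ⟨fun x hx ↦ ?_, fun x hx y hy ↦ ?_, fun x hx hxA ↦ ?_⟩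
  · rw [mem_inter] at hx
    refine mem_filter.2 ⟨hx.2, ?_⟩
    rintro (h | ⟨s, hs, t, ht, h | h⟩)
    · exact hsf x hx.1 x hx.1 (mem_inter.1 h).1
    · exact hsf x hx.1 s (mem_inter.1 hs).1 (h ▸ (mem_inter.1 ht).1)
    · exact hsf s (mem_inter.1 hs).1 t (mem_inter.1 ht).1 (h ▸ hx.1)
  · rintro ⟨-, s, hs, h⟩
    rw [mem_inter] at hx hy hs
    rcases h with h | h | h
    · exact hsf x hx.1 y hy.1 (h ▸ hs.1)
    · exact hsf x hx.1 s hs.1 (h ▸ hy.1)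
    · exact hsf y hy.1 s hs.1 (h ▸ hx.1)
  · rw [mem_filter] at hx
    obtain ⟨hxB, hxl⟩ := hx
    have hxA : x ∉ A := fun h ↦ hxA (mem_inter.2 ⟨h, hxB⟩)
    have hns : ¬ IsSumFree (insert x A : Set G) := fun h ↦ by
      have := hA.2 _ h (Set.subset_insert _ _)
      exact hxA (mem_coe.1 (this ▸ Set.mem_insert x _))
    have hl : ∀ a ∈ A, a ∈ B ∨ a ∈ A ∩ C := fun a ha ↦ by
      rcases mem_union.1 (hABC ha) with h | h
      exacts [.inl h, .inr (mem_inter.2 ⟨ha, h⟩)]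
    have hadj : ∀ y ∈ A, y ∈ B → ∀ s ∈ A ∩ C, (x + y = s ∨ x + s = y ∨ y + s = x) →
        ∃ y ∈ A ∩ B, (linkGraph (A ∩ C)).Adj x y := fun y hy hyB s hs h ↦
      ⟨y, mem_inter.2 ⟨hy, hyB⟩, fun h ↦ hxA (h ▸ hy), s, hs, h⟩
    simp only [IsSumFree, Set.mem_insert_iff, mem_coe, not_forall, not_not] at hns
    obtain ⟨p, hp, q, hq, hr⟩ := hns
    have hx2 : x + x ∉ A ∩ C := fun h ↦ hxl (.inl h)
    have hst1 : ∀ s ∈ A ∩ C, x + s ∉ A ∩ C := fun s hs h ↦ hxl (.inr ⟨s, hs, _, h, .inl rfl⟩)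
    have hst2 : ∀ s ∈ A ∩ C, ∀ t ∈ A ∩ C, s + t ≠ x := fun s hs t ht h ↦
      hxl (.inr ⟨s, hs, _, ht, .inr h⟩)
    rcases hp with rfl | hp <;> rcases hq with rfl | hq
    · rcases hr with hr | hr
      · exact absurd hxB (by rw [show q = 0 by simpa using hr]; exact h0B)
      · rcases hl _ hr with h | h
        exacts [absurd h (hB _ hxB _ hxB), absurd h hx2]
    · rcases hr with hr | hr
      · exact absurd (by simpa using hr) (fun h : q = 0 ↦ h0 (h ▸ hq))
      · rcases hl _ hr with h | h <;> rcases hl _ hq with h' | h'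
        · exact absurd h (hB _ hxB _ h')
        · exact hadj _ hr h q h' (.inr (.inl rfl))
        · exact hadj _ hq h' _ h (.inl rfl)
        · exact absurd h (hst1 _ h')
    · rcases hr with hr | hr
      · exact absurd (by simpa using hr) (fun h : p = 0 ↦ h0 (h ▸ hp))
      · rw [add_comm] at hr
        rcases hl _ hr with h | h <;> rcases hl _ hp with h' | h'
        · exact absurd h (hB _ hxB _ h')
        · exact hadj _ hr h p h' (.inr (.inl rfl))
        · exact hadj _ hp h' _ h (.inl rfl)
        · exact absurd h (hst1 _ h')
    · rcases hr with hr | hr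
      · rcases hl _ hp with h | h <;> rcases hl _ hq with h' | h'
        · exact absurd hxB (hr ▸ hB _ h _ h')
        · exact hadj _ hp h _ h' (.inr (.inr hr))
        · exact hadj _ hq h' _ h (.inr (.inr (by rw [add_comm]; exact hr)))
        · exact absurd hr (hst2 _ h _ h')
      · exact absurd hr (hsf _ hp _ hq)

variable [Fintype G]

/-- The maximal sum-free subsets of `G`. -/
noncomputable def maxSumFree (G : Type*) [AddCommGroup G] [Fintype G] : Finset (Finset G) :=
  {A | IsMaximalSumFree (A : Set G)}

lemma mem_maxSumFree : A ∈ maxSumFree G ↔ IsMaximalSumFree (A : Set G) := by simp [maxSumFree]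

lemma fMaxSF_eq_card : fMaxSF G = #(maxSumFree G) := by
  rw [fMaxSF, ← Fintype.card_coe, ← Nat.card_eq_fintype_card]
  refine Nat.card_congr ((Equiv.subtypeEquiv (Fintype.finsetEquivSet (α := G)) ?_).symm)
  intro A
  simp [maxSumFree]

lemma card_maxSumFree_filter_subset_le (hB : IsSumFree (B : Set G)) :
    #{A ∈ maxSumFree G | A ⊆ B ∪ C} ≤
      ∑ S ∈ C.powerset.filter fun S : Finset G ↦ IsSumFree (S : Set G),
      #(misSets (linkGraph S) {x ∈ B | x ∉ linkLoops S}) := by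
  rw [card_eq_sum_card_fiberwise (f := fun A ↦ A ∩ C)
    (t := {S ∈ C.powerset | IsSumFree (S : Set G)})]
  · refine sum_le_sum fun S _ ↦ card_le_card_of_injOn (fun A ↦ A ∩ B) ?_ ?_
    · intro A hA
      simp only [coe_filter, mem_filter, mem_maxSumFree, Set.mem_ofPred_eq] at hA
      obtain ⟨⟨hA, hABC⟩, rfl⟩ := hA
      exact inter_mem_misSets hA hABC hB
    · intro A hA A' hA' h
      simp only [coe_filter, mem_filter, Set.mem_ofPred_eq] at hA hA' h
      rw [← inter_eq_left.2 hA.1.2, ← inter_eq_left.2 hA'.1.2, inter_union_distrib_left,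
        inter_union_distrib_left, h, hA.2, hA'.2]
  · intro A hA
    simp only [coe_filter, mem_maxSumFree, Set.mem_ofPred_eq, mem_powerset] at hA ⊢
    exact ⟨inter_subset_right, hA.1.1.subset (by simp)⟩

end Link

section MeasureMore

variable {V : Type*} {Γ : SimpleGraph V} {U B X Y : Finset V}

lemma branchMeasure_mono {α β : ℝ} {Δ : ℕ} (hβ : 0 ≤ β) (hα : 0 ≤ α - 2 * Δ * β) (hU : U ⊆ B)
    (hΔ : ∀ v ∈ B, #(nbrsIn Γ B v) ≤ Δ) : branchMeasure Γ α β U ≤ branchMeasure Γ α β B := by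
  have := branchMeasure_sdiff_le (z := 0) (k := 0) hβ le_rfl hα (sdiff_subset (s := B) (t := U)) hΔ
    (by positivity)
  rwa [Finset.sdiff_sdiff_eq_self hU, zero_mul, sub_zero] at this

/-- The bound for graphs in which almost every vertex has four prescribed neighbours. -/
lemma card_misSets_le_of_four_nbrs (N : V → Finset V) (k : ℕ) (hU : U ⊆ B)
    (hNB : ∀ v ∈ B, N v ⊆ B) (hN4 : ∀ v ∈ B, #(N v) ≤ 4)
    (hNs : ∀ v ∈ B, ∀ u ∈ N v, v ∈ N u) (hadj : ∀ v ∈ B, ∀ u ∈ N v, Γ.Adj v u)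
    (hk : #{v ∈ B | #(N v) < 4} ≤ k) :
    (#(misSets Γ U) : ℝ) ≤ 2 ^ (0.4985 * #B + 0.06 * k : ℝ) := by
  let Γ' : SimpleGraph V :=
    { Adj := fun x y ↦ x ∈ B ∧ y ∈ N x
      symm := ⟨fun x y h ↦ ⟨hNB x h.1 h.2, hNs x h.1 y h.2⟩⟩
      loopless := ⟨fun x h ↦ (hadj x h.1 x h.2).ne rfl⟩ }
  have hΓ : Γ' ≤ Γ := fun x y h ↦ hadj x h.1 y h.2
  have hnb : ∀ v ∈ B, nbrsIn Γ' B v = N v := fun v hv ↦ by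
    ext u
    simp only [mem_nbrsIn, Γ']
    exact ⟨fun h ↦ h.2.2, fun h ↦ ⟨hNB v hv h, hv, h⟩⟩
  have hΔ : ∀ v ∈ B, #(nbrsIn Γ' B v) ≤ 4 := fun v hv ↦ hnb v hv ▸ hN4 v hv
  have hE : 4 * #B ≤ adjPairs Γ' B + 4 * k := by
    rw [adjPairs_eq_sum, sum_congr rfl fun v hv ↦ congrArg card (hnb v hv)]
    have h1 : ∑ v ∈ B, 4 ≤ ∑ v ∈ B, (#(N v) + if #(N v) < 4 then 4 else 0) :=
      sum_le_sum fun v _ ↦ by split_ifs <;> omega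
    rw [sum_add_distrib, ← sum_filter, sum_const, sum_const, smul_eq_mul, smul_eq_mul] at h1
    linarith
  have hE' : (4 * #B : ℝ) ≤ adjPairs Γ' B + 4 * k := by exact_mod_cast hE
  refine (card_misSets_le_of_degree_le_four hΓ U fun v hv ↦
    (card_le_card (nbrsIn_mono hU)).trans (hΔ v (hU hv))).trans
    (Real.rpow_le_rpow_of_exponent_le one_le_two ?_)
  refine (branchMeasure_mono (Δ := 4) (by norm_num) (by norm_num) hU hΔ).trans ?_
  rw [branchMeasure]
  linarith

/-- The elements of `Y` without neighbours in `J`. -/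
noncomputable def nonNbrs (Γ : SimpleGraph V) (Y J : Finset V) : Finset V :=
  {y ∈ Y | ∀ x ∈ J, ¬ Γ.Adj x y}

lemma mem_nonNbrs {J : Finset V} {y : V} : y ∈ nonNbrs Γ Y J ↔ y ∈ Y ∧ ∀ x ∈ J, ¬ Γ.Adj x y := by
  simp [nonNbrs]

/-- Maximal independent sets of `X ∪ Y` may be counted by revealing their restriction to `X`
first. -/
lemma card_misSets_union_le :
    #(misSets Γ (X ∪ Y)) ≤ ∑ J ∈ (misSets Γ (X ∪ Y)).image (· ∩ X),
      #(misSets Γ (nonNbrs Γ Y J)) := by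
  rw [card_eq_sum_card_image (· ∩ X)]
  refine sum_le_sum fun J _ ↦ card_le_card_of_injOn (fun I ↦ I ∩ Y) ?_ ?_
  · intro I hI
    simp only [coe_filter, mem_misSets, Set.mem_ofPred_eq] at hI
    obtain ⟨⟨hI, hind, hmax⟩, rfl⟩ := hI
    simp only [mem_coe, mem_misSets, mem_nonNbrs, mem_inter]
    refine ⟨fun y hy ↦ ?_, fun x hx y hy ↦ hind x hx.1 y hy.1, fun x hx hxI ↦ ?_⟩
    · rw [mem_inter] at hy
      exact mem_nonNbrs.2 ⟨hy.2, fun x hx ↦ hind x (mem_inter.1 hx).1 y hy.1⟩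
    · obtain ⟨y, hy, hxy⟩ := hmax x (mem_union_right _ hx.1) fun h ↦ hxI ⟨h, hx.1⟩
      refine ⟨y, ⟨hy, ?_⟩, hxy⟩
      rcases mem_union.1 (hI hy) with h | h
      · exact absurd hxy.symm (hx.2 y ⟨hy, h⟩)
      · exact h
  · intro I hI I' hI' h
    simp only [coe_filter, mem_misSets, Set.mem_ofPred_eq] at hI hI' h
    rw [← inter_eq_left.2 hI.1.1, ← inter_eq_left.2 hI'.1.1, inter_union_distrib_left,
      inter_union_distrib_left, h, hI.2, hI'.2]

/-- If maximal independent sets of `X ∪ Y` stay maximal inside `X`, they may be counted by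
revealing their restriction to `X` first. -/
lemma card_misSets_union_le_mul {M : ℝ} (hM0 : 0 ≤ M)
    (hX : ∀ I ∈ misSets Γ (X ∪ Y), I ∩ X ∈ misSets Γ X)
    (hM : ∀ I ∈ misSets Γ (X ∪ Y), (#(misSets Γ (nonNbrs Γ Y (I ∩ X))) : ℝ) ≤ M) :
    (#(misSets Γ (X ∪ Y)) : ℝ) ≤ #(misSets Γ X) * M := by
  have himg : (misSets Γ (X ∪ Y)).image (· ∩ X) ⊆ misSets Γ X := image_subset_iff.2 hX
  calc (#(misSets Γ (X ∪ Y)) : ℝ)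
      ≤ ∑ J ∈ (misSets Γ (X ∪ Y)).image (· ∩ X),
          (#(misSets Γ (nonNbrs Γ Y J)) : ℝ) := by
        exact_mod_cast card_misSets_union_le
    _ ≤ ∑ J ∈ (misSets Γ (X ∪ Y)).image (· ∩ X), M := sum_le_sum fun J hJ ↦ by
        obtain ⟨I, hI, rfl⟩ := mem_image.1 hJ
        exact hM I hI
    _ ≤ #(misSets Γ X) * M := by
        rw [sum_const, nsmul_eq_mul]
        gcongr

end MeasureMore

section Core

variable {G : Type*} [AddCommGroup G] [Fintype G] {S U : Finset G} {φ : G →+ ZMod 5} {n : ℕ}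

/-- The union of the classes `1` and `4` of a homomorphism to `ZMod 5`. -/
noncomputable def outerClasses (φ : G →+ ZMod 5) : Finset G := {x | φ x = 1 ∨ φ x = 4}

lemma mem_outerClasses {x : G} : x ∈ outerClasses φ ↔ φ x = 1 ∨ φ x = 4 := by
  simp [outerClasses]

lemma outerClasses_neg : outerClasses (-φ) = outerClasses φ := by
  ext x
  simp only [mem_outerClasses, AddMonoidHom.neg_apply]
  generalize φ x = t
  revert t; decide

lemma isSumFree_outerClasses : IsSumFree (outerClasses φ : Set G) := by
  intro x hx y hy h
  simp only [mem_coe, mem_outerClasses, map_add] at hx hy h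
  generalize φ x = s at *
  generalize φ y = t at *
  revert s t; decide

lemma card_outerClasses (hn : ∀ i, #{x | φ x = i} = n) : #(outerClasses φ) = 2 * n := by
  rw [outerClasses, filter_or, card_union_of_disjoint, hn, hn, two_mul]
  rw [disjoint_filter]
  rintro x - h h'
  rw [h] at h'; revert h'; decide

lemma card_double_le (h2 : Function.Injective fun x : G ↦ x + x) (P : Finset G) :
    #{x | x + x ∈ P} ≤ #P :=
  card_le_card_of_injOn (fun x ↦ x + x) (fun x hx ↦ by simpa using hx) h2.injOn

/-- The link graph of a nonzero `a` of class `0` together with another element. -/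
lemma card_misSets_link_le_of_class_zero (h2 : Function.Injective fun x : G ↦ x + x)
    (hn : ∀ i, #{x | φ x = i} = n) {a s : G} (ha : a ∈ S) (hs : s ∈ S) (ha0 : a ≠ 0)
    (hsa : s ≠ a) (hφa : φ a = 0) (hφs : φ s = 0 ∨ φ s = 2) (hU : U ⊆ outerClasses φ) :
    (#(misSets (linkGraph S) U) : ℝ) ≤ 2 ^ (0.997 * n + 0.12 : ℝ) := by
  let p : G → G := fun v ↦ if φ s = 0 then s - v else if φ v = 1 then v - s else v + s
  have hφp : ∀ v ∈ outerClasses φ, φ (p v) = - φ v := fun v hv ↦ by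
    rcases hφs with h | h
    · simp [p, h]
    · have h0 : φ s ≠ 0 := by rw [h]; decide
      rcases mem_outerClasses.1 hv with h' | h'
      · rw [show p v = v - s by simp only [p]; rw [if_neg h0, if_pos h'], map_sub, h, h']; decide
      · have h1 : φ v ≠ 1 := by rw [h']; decide
        rw [show p v = v + s by simp only [p]; rw [if_neg h0, if_neg h1], map_add, h, h']; decide
  have hpp : ∀ v ∈ outerClasses φ, p (p v) = v := fun v hv ↦ by
    have h1 := hφp v hv
    rcases hφs with h | h
    · simp [p, h]
    · have h0 : φ s ≠ 0 := by rw [h]; decide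
      rcases mem_outerClasses.1 hv with h' | h'
      · rw [h'] at h1
        have h1' : φ (p v) ≠ 1 := by rw [h1]; decide
        have : p (p v) = p v + s := by
          generalize p v = w at *
          simp only [p, h0, h1', if_false]
        rw [this]; simp [p, h', h0]
      · rw [h'] at h1
        have h1' : φ (p v) = 1 := by rw [h1]; decide
        have : p (p v) = p v - s := by
          generalize p v = w at *
          simp only [p, h0, h1', if_false, if_true]
        have h41 : φ v ≠ 1 := by rw [h']; decide
        rw [this]; simp [p, h0, h41]
  have hpadj : ∀ v, v + p v = s ∨ v + s = p v ∨ p v + s = v := fun v ↦ by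
    simp only [p]
    split_ifs
    · left; abel
    · right; right; abel
    · right; left; rfl
  have hne : ∀ v ∈ outerClasses φ, φ v ≠ - φ v := fun v hv ↦ by
    rcases mem_outerClasses.1 hv with h | h <;> rw [h] <;> decide
  have hneg : ∀ v ∈ outerClasses φ, ∀ w, φ w = - φ v → w ∈ outerClasses φ := fun v hv w hw ↦ by
    rw [mem_outerClasses, hw]
    rcases mem_outerClasses.1 hv with h | h <;> rw [h] <;> decide
  have hav : ∀ v, φ (a - v) = - φ v := fun v ↦ by simp [hφa]
  have hbad : #({v | v + v = a + s ∨ v + v = a - s} : Finset G) ≤ 2 := by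
    refine (card_le_card ?_).trans ((card_double_le h2 {a + s, a - s}).trans card_le_two)
    intro v; simp
  have := card_misSets_le_of_four_nbrs (Γ := linkGraph S) (B := outerClasses φ) (U := U)
    (fun v ↦ {v + a, v - a, a - v, p v}) 2 hU ?_ ?_ ?_ ?_ ?_
  · rw [card_outerClasses hn] at this
    push_cast at this
    refine this.trans (le_of_eq ?_)
    congr 1; ring
  · intro v hv w hw
    simp only [mem_insert, mem_singleton] at hw
    rcases hw with rfl | rfl | rfl | rfl
    · simpa [mem_outerClasses, hφa] using mem_outerClasses.1 hv
    · simpa [mem_outerClasses, hφa] using mem_outerClasses.1 hv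
    · exact hneg v hv _ (hav v)
    · exact hneg v hv _ (hφp v hv)
  · exact fun v _ ↦ card_le_four
  · intro v hv w hw
    simp only [mem_insert, mem_singleton] at hw ⊢
    rcases hw with rfl | rfl | rfl | rfl
    · simp
    · simp
    · simp
    · simp [hpp v hv]
  · intro v hv w hw
    simp only [mem_insert, mem_singleton] at hw
    rcases hw with rfl | rfl | rfl | rfl
    · exact ⟨by simpa using ha0, a, ha, .inr (.inl rfl)⟩
    · exact ⟨fun h ↦ ha0 (by simpa using h.symm), a, ha, .inr (.inr (by abel))⟩
    · exact ⟨fun h ↦ hne v hv (by rw [← hav v, ← h]), a, ha, .inl (by abel)⟩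
    · exact ⟨fun h ↦ hne v hv (by rw [← hφp v hv, ← h]), s, hs, hpadj v⟩
  · refine (card_le_card fun v hv ↦ ?_).trans hbad
    simp only [mem_filter, mem_univ, true_and] at hv ⊢
    obtain ⟨hv, h4⟩ := hv
    by_contra hcon
    push Not at hcon
    refine absurd h4 (not_lt.2 (le_of_eq ?_))
    have hφadd : φ (v + a) = φ v := by simp [hφa]
    have hφsub : φ (v - a) = φ v := by simp [hφa]
    rw [eq_comm, card_insert_of_notMem, card_insert_of_notMem, card_pair]
    · intro h
      rcases hpadj v with h' | h' | h'
      · rw [← h] at h'; exact hsa (by rw [← h']; abel)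
      · rw [← h, eq_sub_iff_add_eq] at h'; exact hcon.2 (by rw [← h']; abel)
      · rw [← h, sub_add_eq_add_sub, sub_eq_iff_eq_add] at h'; exact hcon.1 h'.symm
    · simp only [mem_insert, mem_singleton, not_or]
      exact ⟨fun h ↦ hne v hv (by rw [← hav v, ← h, hφsub]),
        fun h ↦ hne v hv (by rw [← hφp v hv, ← h, hφsub])⟩
    · simp only [mem_insert, mem_singleton, not_or]
      refine ⟨fun h ↦ ha0 (h2 ?_), fun h ↦ hne v hv (by rw [← hav v, ← h, hφadd]),
        fun h ↦ hne v hv (by rw [← hφp v hv, ← h, hφadd])⟩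
      rw [sub_eq_add_neg, add_right_inj, eq_neg_iff_add_eq_zero] at h
      simpa using h

/-- The link graph of four elements of class `2`. -/
lemma card_misSets_link_le_of_four (hn : ∀ i, #{x | φ x = i} = n) (hS : 4 ≤ #{s ∈ S | φ s = 2})
    (hU : U ⊆ outerClasses φ) :
    (#(misSets (linkGraph S) U) : ℝ) ≤ 2 ^ (0.997 * n + 0.12 : ℝ) := by
  obtain ⟨P, hPS, hP⟩ := exists_subset_card_eq hS
  have hPm : ∀ s ∈ P, s ∈ S ∧ φ s = 2 := fun s hs ↦ mem_filter.1 (hPS hs)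
  let f : G → G → G := fun v s ↦ if φ v = 1 then v - s else v + s
  have h14 : ∀ v, φ v = 4 → φ v ≠ 1 := fun v hv ↦ by rw [hv]; decide
  have hφf : ∀ v ∈ outerClasses φ, ∀ s ∈ P, φ (f v s) = - φ v := fun v hv s hs ↦ by
    have := (hPm s hs).2
    rcases mem_outerClasses.1 hv with h | h
    · rw [show f v s = v - s from if_pos h, map_sub, this, h]; decide
    · rw [show f v s = v + s from if_neg (h14 v h), map_add, this, h]; decide
  have hff : ∀ v ∈ outerClasses φ, ∀ s ∈ P, f (f v s) s = v := fun v hv s hs ↦ by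
    have h1 := hφf v hv s hs
    rcases mem_outerClasses.1 hv with h | h
    · rw [h] at h1
      have e : f (f v s) s = f v s + s := by
        have : φ (f v s) ≠ 1 := by rw [h1]; decide
        generalize f v s = w at *
        simp only [f, this, if_false]
      rw [e]; simp [f, h]
    · rw [h] at h1
      have e : f (f v s) s = f v s - s := by
        have : φ (f v s) = 1 := by rw [h1]; decide
        generalize f v s = w at *
        simp only [f, this, if_true]
      rw [e]; simp [f, h14 v h]
  have hcard : ∀ v, #(P.image (f v)) = 4 := fun v ↦ by
    rw [card_image_of_injective, hP]
    intro s t hst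
    simp only [f] at hst
    split_ifs at hst
    · simpa using hst
    · simpa using hst
  have := card_misSets_le_of_four_nbrs (Γ := linkGraph S) (B := outerClasses φ) (U := U)
    (fun v ↦ P.image (f v)) 2 hU ?_ ?_ ?_ ?_ ?_
  · rw [card_outerClasses hn] at this
    push_cast at this
    refine this.trans (le_of_eq ?_)
    congr 1; ring
  · intro v hv w hw
    obtain ⟨s, hs, rfl⟩ := mem_image.1 hw
    rw [mem_outerClasses, hφf v hv s hs]
    rcases mem_outerClasses.1 hv with h | h <;> rw [h] <;> decide
  · exact fun v _ ↦ (hcard v).le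
  · intro v hv w hw
    obtain ⟨s, hs, rfl⟩ := mem_image.1 hw
    exact mem_image.2 ⟨s, hs, hff v hv s hs⟩
  · intro v hv w hw
    obtain ⟨s, hs, rfl⟩ := mem_image.1 hw
    refine ⟨fun h ↦ ?_, s, (hPm s hs).1, ?_⟩
    · have h1 := hφf v hv s hs
      rw [← h] at h1
      rcases mem_outerClasses.1 hv with h | h <;> rw [h] at h1 <;> revert h1 <;> decide
    · simp only [f]
      split_ifs
      · right; right; abel
      · right; left; rfl
  · simp [hcard]

end Core

section LinkDegrees

variable {G : Type*} [AddCommGroup G] {S B : Finset G} {v : G}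

lemma linkGraph_triangle (hS : IsSumFree (S : Set G))
    (hS3 : ∀ s ∈ S, ∀ t ∈ S, ∀ u ∈ S, s + t + u ≠ 0) {x y z : G} (hxy : (linkGraph S).Adj x y)
    (hyz : (linkGraph S).Adj y z) (hxz : (linkGraph S).Adj x z) :
    x + x ∈ (S ∪ -S) + (S ∪ -S) + (S ∪ -S) := by
  have hQ : ∀ s ∈ S ∪ -S, ∀ t ∈ S ∪ -S, ∀ u ∈ S ∪ -S, s + t + u ≠ 0 := by
    have hsf : ∀ s ∈ S, ∀ t ∈ S, ∀ u ∈ S, s + t ≠ u := fun s hs t ht u hu h ↦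
      hS s hs t ht (h ▸ hu)
    have hneg3 : ∀ {s t u : G}, s + t + u = 0 → -s + -t = u := fun {s t u} h ↦ by
      rw [← neg_add, neg_eq_iff_add_eq_zero, h]
    intro s hs t ht u hu h
    rw [mem_union, mem_neg'] at hs ht hu
    rcases hs with hs | hs <;> rcases ht with ht | ht <;> rcases hu with hu | hu
    · exact hS3 _ hs _ ht _ hu h
    · exact hsf _ hs _ ht _ hu (eq_neg_of_add_eq_zero_left h)
    · exact hsf _ hs _ hu _ ht (eq_neg_of_add_eq_zero_left (by rw [← h]; abel))
    · exact hsf _ ht _ hu _ hs (hneg3 (by rw [← h]; abel))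
    · exact hsf _ ht _ hu _ hs (eq_neg_of_add_eq_zero_left (by rw [← h]; abel))
    · exact hsf _ hs _ hu _ ht (hneg3 (by rw [← h]; abel))
    · exact hsf _ hs _ ht _ hu (hneg3 h)
    · exact hS3 _ hs _ ht _ hu (by rw [← neg_zero, ← h]; abel)
  have hneg : ∀ q ∈ S ∪ -S, -q ∈ S ∪ -S := fun q hq ↦ by
    simp only [mem_union, mem_neg', neg_neg] at hq ⊢; tauto
  have hred : ∀ {x y : G}, (linkGraph S).Adj x y → (x + y ∈ S ∪ -S) ∨ (y - x ∈ S ∪ -S) := by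
    rintro x y ⟨-, s, hs, h | h | h⟩
    · left; rw [h]; exact mem_union_left _ hs
    · right; rw [← h, add_sub_cancel_left]; exact mem_union_left _ hs
    · right; rw [← h]; refine mem_union_right _ (mem_neg'.2 ?_); simpa using hs
  have hmem : ∀ p ∈ S ∪ -S, ∀ q ∈ S ∪ -S, ∀ r ∈ S ∪ -S, x + x = p + q + r →
      x + x ∈ (S ∪ -S) + (S ∪ -S) + (S ∪ -S) := fun p hp q hq r hr h ↦
    h ▸ add_mem_add (add_mem_add hp hq) hr
  rcases hred hxy with h1 | h1 <;> rcases hred hyz with h2 | h2 <;> rcases hred hxz with h3 | h3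
  · exact hmem _ h1 _ (hneg _ h2) _ h3 (by abel)
  · exact (hQ _ h1 _ (hneg _ h2) _ h3 (by abel)).elim
  · exact (hQ _ h1 _ h2 _ (hneg _ h3) (by abel)).elim
  · exact hmem _ h1 _ h2 _ (hneg _ h3) (by abel)
  · exact (hQ _ h1 _ (hneg _ h2) _ h3 (by abel)).elim
  · exact hmem _ h2 _ (hneg _ h1) _ (hneg _ h3) (by abel)
  · exact hmem _ h3 _ (hneg _ h1) _ (hneg _ h2) (by abel)
  · exact (hQ _ h1 _ h2 _ (hneg _ h3) (by abel)).elim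

lemma card_nbrsIn_linkGraph_le : #(nbrsIn (linkGraph S) B v) ≤ 3 * #S := by
  have h : nbrsIn (linkGraph S) B v ⊆
      S.image (fun s ↦ s - v) ∪ (S.image (fun s ↦ v + s) ∪ S.image (fun s ↦ v - s)) := by
    intro u hu
    obtain ⟨-, -, s, hs, h⟩ := mem_nbrsIn.1 hu
    simp only [mem_union, mem_image]
    rcases h with h | h | h
    · exact .inl ⟨s, hs, by rw [← h]; abel⟩
    · exact .inr (.inl ⟨s, hs, h⟩)
    · exact .inr (.inr ⟨s, hs, by rw [← h]; abel⟩)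
  have h1 := (card_le_card h).trans (card_union_le _ _)
  have h2 := card_union_le (S.image (fun s ↦ v + s)) (S.image (fun s ↦ v - s))
  have h3 := card_image_le (s := S) (f := fun s ↦ s - v)
  have h4 := card_image_le (s := S) (f := fun s ↦ v + s)
  have h5 := card_image_le (s := S) (f := fun s ↦ v - s)
  omega

end LinkDegrees

section Core

variable {G : Type*} [AddCommGroup G] [Fintype G] {S U : Finset G} {φ : G →+ ZMod 5} {n : ℕ}

/-- The link graph of a small set. -/
lemma card_misSets_link_le_of_few (h2 : Function.Injective fun x : G ↦ x + x)
    (hn : ∀ i, #{x | φ x = i} = n) (hS : IsSumFree (S : Set G))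
    (hS3 : ∀ s ∈ S, ∀ t ∈ S, ∀ u ∈ S, s + t + u ≠ 0) (h6 : #S ≤ 6)
    (hE : 3 * n ≤ adjPairs (linkGraph S) (outerClasses φ) + 2) (hU : U ⊆ outerClasses φ) :
    (#(misSets (linkGraph S) U) : ℝ) ≤ 2 ^ (0.9995 * n + 1729 : ℝ) := by
  set D : Finset G := {x | x + x ∈ (S ∪ -S) + (S ∪ -S) + (S ∪ -S)} with hD
  have hΔ : ∀ v, ∀ B, #(nbrsIn (linkGraph S) B v) ≤ 18 := fun v B ↦
    card_nbrsIn_linkGraph_le.trans (by omega)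
  have hQ : #(S ∪ -S) ≤ 12 := (card_union_le _ _).trans (by rw [card_neg]; omega)
  have hDcard : #D ≤ 1728 := by
    refine (card_double_le h2 _).trans (card_add_le.trans ?_)
    calc _ ≤ #(S ∪ -S) * #(S ∪ -S) * #(S ∪ -S) := Nat.mul_le_mul_right _ card_add_le
      _ ≤ 12 * 12 * 12 := by gcongr
  set m := branchMeasure (linkGraph S) 0.5005 0.0005 (outerClasses φ) with hm
  have hmn : m ≤ 0.9995 * n + 1 := by
    rw [hm, branchMeasure, card_outerClasses hn]
    have : (3 * n : ℝ) ≤ adjPairs (linkGraph S) (outerClasses φ) + 2 := by exact_mod_cast hE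
    push_cast
    linarith
  have := card_misSets_le_of_sdiff (Γ := linkGraph S) (M := 2 ^ m) D U fun W hW ↦ by
    refine (card_misSets_le_of_triangle_free W (fun v _ ↦ hΔ v W) ?_).trans
      (Real.rpow_le_rpow_of_exponent_le one_le_two (branchMeasure_mono (Δ := 18) (by norm_num)
        (by norm_num) ((hW.trans sdiff_subset).trans hU) fun v _ ↦ hΔ v _))
    intro x hx y hy z hz hxy hyz hxz
    refine (mem_sdiff.1 (hW hx)).2 ?_
    simpa [hD] using linkGraph_triangle hS hS3 hxy hyz hxz
  refine this.trans ?_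
  rw [← Real.rpow_natCast, ← Real.rpow_add two_pos]
  refine Real.rpow_le_rpow_of_exponent_le one_le_two ?_
  have : (#D : ℝ) ≤ 1728 := by exact_mod_cast hDcard
  linarith

lemma three_mul_le_adjPairs_of_class_zero (h2 : Function.Injective fun x : G ↦ x + x)
    (hn : ∀ i, #{x | φ x = i} = n) {a : G} (ha : a ∈ S) (ha0 : a ≠ 0) (hφa : φ a = 0) :
    3 * n ≤ adjPairs (linkGraph S) (outerClasses φ) := by
  have h : ∀ v ∈ outerClasses φ, 2 ≤ #(nbrsIn (linkGraph S) (outerClasses φ) v) := fun v hv ↦ by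
    have hne : v + a ≠ v - a := fun h ↦ ha0 (h2 (by
      rw [sub_eq_add_neg, add_right_inj, eq_neg_iff_add_eq_zero] at h
      simpa using h))
    rw [← card_pair hne]
    refine card_le_card fun w hw ↦ ?_
    rw [mem_nbrsIn, mem_outerClasses]
    rw [mem_outerClasses] at hv
    rcases mem_insert.1 hw with rfl | hw
    · exact ⟨by simpa [hφa] using hv, by simpa using ha0, a, ha, .inr (.inl rfl)⟩
    · rw [mem_singleton.1 hw]
      exact ⟨by simpa [hφa] using hv, fun h ↦ ha0 (by simpa using h.symm), a, ha,
        .inr (.inr (by abel))⟩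
  have := card_nsmul_le_sum _ _ _ h
  rw [← adjPairs_eq_sum, card_outerClasses hn, smul_eq_mul] at this
  omega

lemma three_mul_le_adjPairs_of_class_two (h2 : Function.Injective fun x : G ↦ x + x)
    (hn : ∀ i, #{x | φ x = i} = n) {s : G} (hs : s ∈ S) (hφs : φ s = 2) :
    3 * n ≤ adjPairs (linkGraph S) (outerClasses φ) + 1 := by
  have h : ∀ v ∈ outerClasses φ, 1 + (if φ v = 1 then 1 else 0) ≤
      #(nbrsIn (linkGraph S) (outerClasses φ) v) + if v + v = s then 1 else 0 := fun v hv ↦ by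
    rcases mem_outerClasses.1 hv with h | h
    · have h1 : v - s ∈ nbrsIn (linkGraph S) (outerClasses φ) v := by
        have hφ : φ (v - s) = 4 := by rw [map_sub, h, hφs]; decide
        refine mem_nbrsIn.2 ⟨mem_outerClasses.2 (.inr hφ), fun e ↦ ?_, s, hs, .inr (.inr (by abel))⟩
        rw [← e, h] at hφ; revert hφ; decide
      rw [if_pos h]
      split_ifs with hv2
      · have := card_pos.2 ⟨_, h1⟩; omega
      · have h3 : s - v ∈ nbrsIn (linkGraph S) (outerClasses φ) v := by
          refine mem_nbrsIn.2 ⟨mem_outerClasses.2 (.inl ?_), fun e ↦ hv2 ?_, s, hs,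
            .inl (by abel)⟩
          · rw [map_sub, h, hφs]; decide
          · rwa [eq_sub_iff_add_eq] at e
        have hne : v - s ≠ s - v := fun e ↦ by
          have := congrArg φ e
          rw [map_sub, map_sub, h, hφs] at this
          revert this; decide
        have := card_le_card (insert_subset h1 (singleton_subset_iff.2 h3))
        rw [card_pair hne] at this
        omega
    · have h1 : v + s ∈ nbrsIn (linkGraph S) (outerClasses φ) v := by
        have hφ : φ (v + s) = 1 := by rw [map_add, h, hφs]; decide
        refine mem_nbrsIn.2 ⟨mem_outerClasses.2 (.inl hφ), fun e ↦ ?_, s, hs, .inr (.inl rfl)⟩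
        rw [← e, h] at hφ; revert hφ; decide
      have h4 : φ v ≠ 1 := by rw [h]; decide
      rw [if_neg h4]
      have := card_pos.2 ⟨_, h1⟩; omega
  have := sum_le_sum h
  rw [sum_add_distrib, sum_add_distrib, ← adjPairs_eq_sum, sum_const, ← card_filter,
    ← card_filter, card_outerClasses hn, smul_eq_mul] at this
  have h3 : #{v ∈ outerClasses φ | φ v = 1} = n := by
    rw [← hn 1]; congr 1; ext v; simp +contextual [mem_outerClasses]
  have h4 : #{v ∈ outerClasses φ | v + v = s} ≤ 1 := by
    refine (card_le_card ?_).trans ((card_double_le h2 {s}).trans (card_singleton s).le)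
    intro v; simp
  omega

/-- The link graph of an element of order three. -/
lemma card_misSets_link_le_of_order_three
    (hn : ∀ i, #{x | φ x = i} = n) {a : G} (ha0 : a ≠ 0) (hφa : φ a = 0) (ha3 : a + a + a = 0) :
    (#(misSets (linkGraph {a}) (outerClasses φ)) : ℝ) ≤ 2 ^ (0.9995 * n : ℝ) := by
  set Γ := linkGraph ({a} : Finset G) with hΓ
  have hadj : ∀ x y, Γ.Adj x y ↔ x ≠ y ∧ (x + y = a ∨ x + a = y ∨ y + a = x) := fun x y ↦ by
    simp [hΓ, linkGraph]
  set X : Finset G := {x | φ x = 1} with hX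
  set Y : Finset G := {x | φ x = 4} with hY
  have hXY : outerClasses φ = X ∪ Y := by rw [outerClasses, filter_or]
  have key : ∀ I ∈ misSets Γ (X ∪ Y), ∀ x ∈ X, x ∈ I ∨ x + a ∈ I ∨ x + a + a ∈ I := by
    intro I hI x hx
    obtain ⟨hIU, hind, hmax⟩ := mem_misSets.1 hI
    simp only [hX, mem_filter, mem_univ, true_and] at hx
    by_contra hcon
    push Not at hcon
    have hnb : ∀ z, φ z = 1 → z ∉ I → z + a ∉ I → z + a + a ∉ I → a - z ∈ I := by
      intro z hz h1 h2 h3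
      obtain ⟨y, hy, hzy⟩ := hmax z (by simp [hX, hz]) h1
      rcases ((hadj _ _).1 hzy).2 with h | h | h
      · rwa [← h, add_sub_cancel_left]
      · exact absurd (h ▸ hy) h2
      · refine absurd hy ?_
        rwa [show y = z + a + a by rw [← h, add_assoc, add_assoc, ← add_assoc a, ha3, add_zero]]
    have hxa : x + a + a + a = x := by rw [add_assoc, add_assoc, ← add_assoc a, ha3, add_zero]
    have h1 := hnb x hx hcon.1 hcon.2.1 hcon.2.2
    have h2 := hnb (x + a) (by simp [hx, hφa]) hcon.2.1 hcon.2.2 (by rw [hxa]; exact hcon.1)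
    refine hind _ h2 _ h1 ((hadj _ _).2 ⟨fun h ↦ ha0 ?_, .inr (.inl (by abel))⟩)
    simpa using sub_right_inj.1 h
  have h1 : ∀ I ∈ misSets Γ (X ∪ Y), I ∩ X ∈ misSets Γ X ∧ n ≤ 3 * #(I ∩ X) := by
    intro I hI
    have hk := key I hI
    obtain ⟨hIU, hind, hmax⟩ := mem_misSets.1 hI
    have hXa : ∀ x ∈ X, x + a ∈ X := fun x hx ↦ by simpa [hX, hφa] using hx
    have hk' : ∀ x ∈ X, x ∈ I ∩ X ∨ x + a ∈ I ∩ X ∨ x + a + a ∈ I ∩ X := fun x hx ↦ by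
      simpa [hx, hXa] using hk x hx
    refine ⟨mem_misSets.2 ⟨inter_subset_right, fun x hx y hy ↦ hind x (mem_of_mem_inter_left hx) y
      (mem_of_mem_inter_left hy), fun x hx hxI ↦ ?_⟩, ?_⟩
    · rcases hk' x hx with h | h | h
      · exact absurd h hxI
      · exact ⟨_, h, (hadj _ _).2 ⟨by simpa using ha0, .inr (.inl rfl)⟩⟩
      · refine ⟨_, h, (hadj _ _).2 ⟨fun e ↦ hxI (e ▸ h), .inr (.inr ?_)⟩⟩
        rw [add_assoc, add_assoc, ← add_assoc a, ha3, add_zero]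
    · have hsub : X ⊆ (I ∩ X) ∪ ((I ∩ X).image (· - a) ∪ (I ∩ X).image (· - a - a)) := by
        intro x hx
        simp only [mem_union, mem_image]
        rcases hk' x hx with h | h | h
        · exact .inl h
        · exact .inr (.inl ⟨_, h, by abel⟩)
        · exact .inr (.inr ⟨_, h, by abel⟩)
      have e1 := (card_le_card hsub).trans (card_union_le _ _)
      have e2 := card_union_le ((I ∩ X).image (· - a)) ((I ∩ X).image (· - a - a))
      have e3 := card_image_le (s := I ∩ X) (f := (· - a))
      have e4 := card_image_le (s := I ∩ X) (f := (· - a - a))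
      have e5 : #X = n := hn 1
      omega
  have h2 : ∀ I ∈ misSets Γ (X ∪ Y), (#(misSets Γ (nonNbrs Γ Y (I ∩ X))) : ℝ) ≤
      2 ^ (0.5285 * (2 / 3 * n) : ℝ) := by
    intro I hI
    obtain ⟨hJ, hJn⟩ := h1 I hI
    generalize I ∩ X = J at hJ hJn ⊢
    refine (card_misSets_le_two_rpow _).trans (Real.rpow_le_rpow_of_exponent_le one_le_two ?_)
    have hJX : ∀ x ∈ J, φ x = 1 := fun x hx ↦ by simpa [hX] using (mem_misSets.1 hJ).1 hx
    have hd : Disjoint (nonNbrs Γ Y J) (J.image (a - ·)) := by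
      rw [disjoint_left]
      intro y hy hyJ
      obtain ⟨x, hx, rfl⟩ := mem_image.1 hyJ
      rw [mem_nonNbrs] at hy
      refine hy.2 x hx ((hadj _ _).2 ⟨fun e ↦ ?_, .inl (by abel)⟩)
      have := congrArg φ e
      rw [map_sub, hJX x hx, hφa] at this
      revert this; decide
    have hsub : (nonNbrs Γ Y J) ∪ J.image (a - ·) ⊆ Y := by
      refine union_subset (fun y hy ↦ (mem_nonNbrs.1 hy).1) fun y hy ↦ ?_
      obtain ⟨x, hx, rfl⟩ := mem_image.1 hy
      simp only [hY, mem_filter, mem_univ, true_and, map_sub, hJX x hx, hφa]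
      decide
    have hc := card_le_card hsub
    rw [card_union_of_disjoint hd, card_image_of_injective _ (sub_right_injective),
      show #Y = n from hn 4] at hc
    have hc' : (#(nonNbrs Γ Y J) : ℝ) + #J ≤ n := by exact_mod_cast hc
    have hJn' : (n : ℝ) ≤ 3 * #J := by exact_mod_cast hJn
    linarith
  have h3 := card_misSets_le_two_rpow (Γ := Γ) X
  rw [show #X = n from hn 1] at h3
  rw [hXY]
  have h4 := card_misSets_union_le_mul (M := 2 ^ (0.5285 * (2 / 3 * n) : ℝ)) (by positivity)
    (fun I hI ↦ (h1 I hI).1) h2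
  refine h4.trans ((mul_le_mul_of_nonneg_right h3 (by positivity)).trans ?_)
  rw [← Real.rpow_add two_pos]
  refine Real.rpow_le_rpow_of_exponent_le one_le_two ?_
  have : (0 : ℝ) ≤ n := by positivity
  linarith

/-- The number of maximal sum-free sets with a prescribed trace outside the extremal sum-free set
`outerClasses φ` is exponentially smaller than `2 ^ n`. -/
theorem card_misSets_link_le (h2 : Function.Injective fun x : G ↦ x + x)
    (hn : ∀ i, #{x | φ x = i} = n) (hS : IsSumFree (S : Set G))
    (hSB : ∀ s ∈ S, s ∉ outerClasses φ) :
    (#(misSets (linkGraph S) {x ∈ outerClasses φ | x ∉ linkLoops S}) : ℝ) ≤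
      2 ^ (0.9995 * n + 1729 : ℝ) := by
  have hn0 : (0 : ℝ) ≤ n := by positivity
  have hn' : ∀ i, #{x | (-φ) x = i} = n := fun i ↦ by
    rw [← hn (-i)]; simp [neg_eq_iff_eq_neg]
  have hU : {x ∈ outerClasses φ | x ∉ linkLoops S} ⊆ outerClasses φ := filter_subset _ _
  have hU' : {x ∈ outerClasses φ | x ∉ linkLoops S} ⊆ outerClasses (-φ) := by
    rwa [outerClasses_neg]
  have h0 : ∀ s ∈ S, s ≠ 0 := fun s hs h ↦ hS 0 (h ▸ hs) 0 (h ▸ hs) (by simpa using h ▸ hs)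
  have hcl : ∀ s ∈ S, φ s = 0 ∨ φ s = 2 ∨ φ s = 3 := fun s hs ↦ by
    have := hSB s hs
    rw [mem_outerClasses] at this
    generalize φ s = t at *
    revert t; decide
  have hneg2 : ∀ s, φ s = 3 → (-φ) s = 2 := fun s hs ↦ by
    rw [AddMonoidHom.neg_apply, hs]; decide
  have hle : (2 : ℝ) ^ (0.997 * n + 0.12 : ℝ) ≤ 2 ^ (0.9995 * n + 1729 : ℝ) :=
    Real.rpow_le_rpow_of_exponent_le one_le_two (by linarith)
  rcases S.eq_empty_or_nonempty with rfl | ⟨s₀, hs₀⟩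
  · have : #(misSets (linkGraph ∅) {x ∈ outerClasses φ | x ∉ linkLoops (∅ : Finset G)}) ≤ 1 := by
      refine card_le_one.2 ?_
      have : ∀ I ∈ misSets (linkGraph ∅) {x ∈ outerClasses φ | x ∉ linkLoops (∅ : Finset G)},
          I = {x ∈ outerClasses φ | x ∉ linkLoops (∅ : Finset G)} := fun I hI ↦ by
        obtain ⟨hIU, -, hmax⟩ := mem_misSets.1 hI
        refine hIU.antisymm fun x hx ↦ ?_
        by_contra hxI
        obtain ⟨y, -, -, s, hs, -⟩ := hmax x hx hxI
        exact notMem_empty s hs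
      exact fun I hI J hJ ↦ (this I hI).trans (this J hJ).symm
    calc _ ≤ (1 : ℝ) := by exact_mod_cast this
      _ ≤ _ := Real.one_le_rpow one_le_two (by linarith)
  by_cases hz : ∃ a ∈ S, φ a = 0
  · obtain ⟨a, ha, hφa⟩ := hz
    by_cases hs : ∃ s ∈ S, s ≠ a
    · obtain ⟨s, hs, hsa⟩ := hs
      rcases hcl s hs with h | h | h
      · exact (card_misSets_link_le_of_class_zero h2 hn ha hs (h0 a ha) hsa hφa (.inl h)
          hU).trans hle
      · exact (card_misSets_link_le_of_class_zero h2 hn ha hs (h0 a ha) hsa hφa (.inr h)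
          hU).trans hle
      · exact (card_misSets_link_le_of_class_zero h2 hn' ha hs (h0 a ha) hsa
          (by simp [hφa]) (.inr (hneg2 s h)) hU').trans hle
    · push Not at hs
      obtain rfl : S = {a} := eq_singleton_iff_unique_mem.2 ⟨ha, hs⟩
      by_cases ha3 : a + a + a = 0
      · have hloop : {x ∈ outerClasses φ | x ∉ linkLoops {a}} = outerClasses φ := by
          refine filter_true_of_mem fun x hx hl ↦ ?_
          rw [mem_outerClasses] at hx
          simp only [linkLoops, mem_singleton, exists_eq_left, Set.mem_ofPred_eq] at hl
          rcases hl with h | h | h <;> have := congrArg φ h <;>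
            simp only [map_add, hφa] at this <;> rcases hx with hx | hx <;> rw [hx] at this <;>
            revert this <;> decide
        rw [hloop]
        exact (card_misSets_link_le_of_order_three hn (h0 a ha) hφa ha3).trans
          (Real.rpow_le_rpow_of_exponent_le one_le_two (by linarith))
      · refine card_misSets_link_le_of_few h2 hn hS (by simpa using ha3) (by simp) ?_ hU
        exact (three_mul_le_adjPairs_of_class_zero h2 hn ha (h0 a ha) hφa).trans (by omega)
  push Not at hz
  by_cases h4 : 4 ≤ #{s ∈ S | φ s = 2}
  · exact (card_misSets_link_le_of_four hn h4 hU).trans hle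
  by_cases h4' : 4 ≤ #{s ∈ S | (-φ) s = 2}
  · exact (card_misSets_link_le_of_four hn' h4' hU').trans hle
  have h6 : #S ≤ 6 := by
    have : S ⊆ {s ∈ S | φ s = 2} ∪ {s ∈ S | (-φ) s = 2} := fun s hs ↦ by
      rcases hcl s hs with h | h | h
      · exact absurd h (hz s hs)
      · exact mem_union_left _ (mem_filter.2 ⟨hs, h⟩)
      · exact mem_union_right _ (mem_filter.2 ⟨hs, hneg2 s h⟩)
    have := (card_le_card this).trans (card_union_le _ _)
    omega
  have hS3 : ∀ s ∈ S, ∀ t ∈ S, ∀ u ∈ S, s + t + u ≠ 0 := fun s hs t ht u hu h ↦ by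
    have := congrArg φ h
    rw [map_add, map_add, map_zero] at this
    rcases (hcl s hs).resolve_left (hz s hs) with hs | hs <;>
      rcases (hcl t ht).resolve_left (hz t ht) with ht | ht <;>
      rcases (hcl u hu).resolve_left (hz u hu) with hu | hu <;>
      rw [hs, ht, hu] at this <;> revert this <;> decide
  rcases (hcl s₀ hs₀).resolve_left (hz s₀ hs₀) with h | h
  · exact card_misSets_link_le_of_few h2 hn hS hS3 h6
      ((three_mul_le_adjPairs_of_class_two h2 hn hs₀ h).trans (by omega)) hU
  · exact card_misSets_link_le_of_few h2 hn' hS hS3 h6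
      ((three_mul_le_adjPairs_of_class_two h2 hn' hs₀ (hneg2 s₀ h)).trans (by omega)) hU'

end Core

section Mann

variable {G : Type*} [AddCommGroup G] [Fintype G]

/-- Mann's theorem for `B + B`: a set with small doubling is close to a union of cosets of a
subgroup. -/
lemma exists_addSubgroup_of_card_add_lt {B : Finset G} (hBB : B + B ≠ univ)
    (hB : #(B + B) + 1 < 2 * #B) :
    ∃ H : AddSubgroup G, ({x | ∃ b ∈ B, x - b ∈ H} : Finset G) ≠ univ ∧
      #{x | ∃ b ∈ B, x - b ∈ H} + 1 < #{x | x ∈ H} + #B := by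
  have hBne : B.Nonempty := card_pos.1 (by omega)
  let fam : Finset (Finset G) := {X | X.Nonempty ∧ X + B ≠ univ}
  have hfam : ∀ X, X ∈ fam ↔ X.Nonempty ∧ X + B ≠ univ := fun X ↦ by simp [fam]
  let d : Finset G → ℤ := fun X ↦ #(X + B) - #X
  obtain ⟨F₀, hF₀, hd₀⟩ := exists_min_image fam d ⟨B, (hfam B).2 ⟨hBne, hBB⟩⟩
  obtain ⟨F, hF, hmin⟩ := exists_min_image {X ∈ fam | d X = d F₀} card
    ⟨F₀, mem_filter.2 ⟨hF₀, rfl⟩⟩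
  rw [mem_filter, hfam] at hF
  obtain ⟨⟨hFne, hFu⟩, hdF⟩ := hF
  rw [← hdF] at hmin hd₀
  have hdmin : ∀ X : Finset G, X.Nonempty → X + B ≠ univ → d F ≤ d X := fun X h1 h2 ↦
    hd₀ X ((hfam X).2 ⟨h1, h2⟩)
  have hcmin : ∀ X : Finset G, X.Nonempty → X + B ≠ univ → d X ≤ d F → #F ≤ #X :=
    fun X h1 h2 h3 ↦ hmin X (mem_filter.2 ⟨(hfam X).2 ⟨h1, h2⟩, h3.antisymm (hdmin X h1 h2)⟩)
  have hdual : (2 * #F : ℤ) + d F ≤ Fintype.card G := by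
    set Z := -(F + B)ᶜ with hZ
    have hZc : (#Z : ℤ) = Fintype.card G - #(F + B) := by
      rw [hZ, card_neg, card_compl, Nat.cast_sub (card_le_univ _)]
    have hZB : Z + B ⊆ -(Fᶜ) := by
      intro w hw
      obtain ⟨z, hz, b, hb, rfl⟩ := mem_add.1 hw
      rw [hZ, mem_neg', mem_compl] at hz
      rw [mem_neg', mem_compl]
      intro h
      exact hz (by simpa using add_mem_add h hb)
    have hZBc : (#(Z + B) : ℤ) ≤ Fintype.card G - #F := by
      have := card_le_card hZB
      rw [card_neg, card_compl] at this
      have := card_le_univ F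
      omega
    have hZne : Z.Nonempty := by
      rw [hZ, neg_nonempty_iff, nonempty_iff_ne_empty, Ne, compl_eq_empty_iff]; exact hFu
    have hZu : Z + B ≠ univ := fun h ↦ by
      rw [h, card_univ] at hZBc
      have := card_pos.2 hFne
      omega
    have := hcmin Z hZne hZu (by simp only [d]; omega)
    simp only [d]; omega
  have hatom : ∀ g : G, (F ∩ (g +ᵥ F)).Nonempty → F = g +ᵥ F := by
    intro g hg
    have hg1 : (g +ᵥ F) + B = g +ᵥ (F + B) := vadd_add_assoc _ _ _
    have hsub : (F ∩ (g +ᵥ F)) + B ⊆ (F + B) ∩ ((g +ᵥ F) + B) :=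
      subset_inter (add_subset_add_right inter_subset_left)
        (add_subset_add_right inter_subset_right)
    have h1 := card_le_card hsub
    have h2 := card_union_add_card_inter (F + B) ((g +ᵥ F) + B)
    have h3 := card_union_add_card_inter F (g +ᵥ F)
    rw [← union_add, hg1, card_vadd_finset] at h2
    rw [card_vadd_finset] at h3
    rw [hg1] at h1
    have hXu : (F ∩ (g +ᵥ F)) + B ≠ univ := fun h ↦ hFu (univ_subset_iff.1
      (h ▸ hsub.trans inter_subset_left))
    have h4 := hdmin _ hg hXu
    have hXpos := card_pos.2 hg
    have hle : #F ≤ #(F ∩ (g +ᵥ F)) := by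
      by_cases hY : (F ∪ (g +ᵥ F)) + B = univ
      · rw [hY, card_univ] at h2
        simp only [d] at *
        omega
      · have h5 := hdmin _ (hFne.mono subset_union_left) hY
        refine hcmin _ hg hXu ?_
        simp only [d] at *
        omega
    have h6 := eq_of_subset_of_card_le inter_subset_left hle
    refine eq_of_subset_of_card_le (inter_eq_left.1 h6) ?_
    rw [card_vadd_finset]
  obtain ⟨f, hf⟩ := hFne
  set K := -f +ᵥ F with hK
  have h0K : (0 : G) ∈ K := mem_vadd_finset.2 ⟨f, hf, by simp⟩
  have hKadd : ∀ g ∈ K, g +ᵥ K = K := by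
    intro g hg
    obtain ⟨f', hf', rfl⟩ := mem_vadd_finset.1 hg
    have := hatom (f' - f) ⟨f', mem_inter.2 ⟨hf', mem_vadd_finset.2 ⟨f, hf, by simp⟩⟩⟩
    have e : (-f +ᵥ f') = f' - f := by rw [vadd_eq_add]; abel
    rw [e, hK, vadd_comm, ← this]
  let H : AddSubgroup G :=
    { carrier := K
      zero_mem' := h0K
      add_mem' := fun {x y} hx hy ↦ by
        have : x + y ∈ x +ᵥ K := mem_vadd_finset.2 ⟨y, hy, rfl⟩
        rwa [hKadd x hx] at this
      neg_mem' := fun {x} hx ↦ by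
        have h0 := h0K
        rw [← hKadd x hx] at h0
        obtain ⟨y, hy, hxy⟩ := mem_vadd_finset.1 h0
        rwa [← eq_neg_of_add_eq_zero_right hxy] }
  have hH : ∀ x, x ∈ H ↔ x ∈ K := fun x ↦ Iff.rfl
  have hC : ({x | ∃ b ∈ B, x - b ∈ H} : Finset G) = K + B := by
    ext x
    simp only [mem_filter, mem_univ, true_and, mem_add, hH]
    constructor
    · rintro ⟨b, hb, h⟩; exact ⟨_, h, b, hb, by abel⟩
    · rintro ⟨k, hk, b, hb, rfl⟩; exact ⟨b, hb, by simpa⟩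
  have hKB : K + B = -f +ᵥ (F + B) := vadd_add_assoc _ _ _
  refine ⟨H, ?_, ?_⟩
  · rw [hC, hKB]
    intro h
    exact hFu (by rw [← card_eq_iff_eq_univ, ← card_vadd_finset (-f), h, card_univ])
  · rw [hC, hKB, card_vadd_finset, show ({x | x ∈ H} : Finset G) = K by ext; simp [hH], hK,
      card_vadd_finset]
    have := hdmin B hBne hBB
    simp only [d] at this
    omega

end Mann

section Stability

variable {G : Type*} [AddCommGroup G] [Fintype G]

lemma exists_hom_of_card_eq_five {B : Finset G} (hB : IsSumFree (B : Set G))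
    (hne : B.Nonempty) (hG : Fintype.card G = 5) :
    ∃ φ : G →+ ZMod 5, B ⊆ outerClasses φ := by
  have hz : ∀ z : ZMod 5, z ≠ 0 → z ≠ 2 → z ≠ 3 → z = 1 ∨ z = 4 := by decide
  have : Fact (Nat.Prime 5) := ⟨by norm_num⟩
  have hcard : Nat.card G = 5 := by rw [Nat.card_eq_fintype_card, hG]
  have hc : IsAddCyclic G := isAddCyclic_of_prime_card hcard
  let e : ZMod 5 ≃+ G :=
    (ZMod.ringEquivCongr hcard.symm).toAddEquiv.trans (zmodAddCyclicAddEquiv hc)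
  obtain ⟨x, hx⟩ := hne
  have hx0 : e.symm x ≠ 0 := fun h ↦ hB.zero_notMem (by
    rw [EmbeddingLike.map_eq_zero_iff] at h; exact mem_coe.2 (h ▸ hx))
  have hx1 : (e.symm x)⁻¹ * e.symm x = 1 := inv_mul_cancel₀ hx0
  let φ : G →+ ZMod 5 := (AddMonoidHom.mulLeft (e.symm x)⁻¹).comp e.symm.toAddMonoidHom
  have hφ : ∀ y, φ y = (e.symm x)⁻¹ * e.symm y := fun y ↦ rfl
  have hinj : ∀ y z, φ y = φ z → y = z := fun y z h ↦ e.symm.injective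
    (mul_left_cancel₀ (inv_ne_zero hx0) (by rwa [hφ, hφ] at h))
  have hφx : φ x = 1 := hx1
  refine ⟨φ, fun y hy ↦ mem_outerClasses.2 ?_⟩
  have h0 : φ y ≠ 0 := fun h ↦ hB.zero_notMem (by
    rw [← hinj y 0 (by rw [h, map_zero])]; exact mem_coe.2 hy)
  have h2 : φ y ≠ 2 := fun h ↦ hB x hx x hx (by
    rw [← hinj y (x + x) (by rw [h, map_add, hφx]; rfl)]; exact mem_coe.2 hy)
  have h3 : φ y ≠ 3 := fun h ↦ hB y hy y hy (by
    rw [← hinj x (y + y) (by rw [hφx, map_add, h]; rfl)]; exact mem_coe.2 hx)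
  exact hz _ h0 h2 h3

lemma isSumFree_image_mk {B : Finset G} (hB : IsSumFree (B : Set G)) {H : AddSubgroup G}
    (hu : ({x | ∃ b ∈ B, x - b ∈ H} : Finset G) ≠ univ)
    (hc : #{x | ∃ b ∈ B, x - b ∈ H} + 1 < #{x | x ∈ H} + #B)
    (hd : Fintype.card G < 4 * #B) :
    IsSumFree (B.image (QuotientAddGroup.mk' H) : Set (G ⧸ H)) := by
  set h := #({x | x ∈ H} : Finset G) with hh
  have hcoset : ∀ p, #({x | x - p ∈ H} : Finset G) = h := fun p ↦ by
    rw [hh, ← card_vadd_finset p ({x | x ∈ H} : Finset G)]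
    congr 1
    ext x
    simp only [mem_vadd_finset, mem_filter, mem_univ, true_and, vadd_eq_add]
    exact ⟨fun hx ↦ ⟨_, hx, by abel⟩, by rintro ⟨y, hy, rfl⟩; simpa⟩
  have hD : ∀ p ∈ B, ∀ q ∈ B, p - q ∉ H →
      h < #{x ∈ B | x - p ∈ H} + #{x ∈ B | x - q ∈ H} := by
    intro p hp q hq hpq
    have hdisj : ∀ x, x - p ∈ H → x - q ∉ H := fun x h1 h2 ↦ hpq (by
      have := H.sub_mem h2 h1; rwa [sub_sub_sub_cancel_left] at this)
    have h1 : ({x | x - p ∈ H} : Finset G) ∪ ({x | x - q ∈ H} : Finset G) ∪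
        {x ∈ B | x - p ∉ H ∧ x - q ∉ H} ⊆
        ({x | ∃ b ∈ B, x - b ∈ H} : Finset G) := by
      intro x hx
      simp only [mem_union, mem_filter, mem_univ, true_and] at hx ⊢
      rcases hx with (hx | hx) | hx
      exacts [⟨p, hp, hx⟩, ⟨q, hq, hx⟩, ⟨x, hx.1, by simp⟩]
    have h2 := card_le_card h1
    rw [card_union_of_disjoint, card_union_of_disjoint, hcoset, hcoset] at h2
    · have h3 : #B ≤ #{x ∈ B | x - p ∈ H} + #{x ∈ B | x - q ∈ H} +
          #{x ∈ B | x - p ∉ H ∧ x - q ∉ H} := by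
        refine le_trans (card_le_card fun x hx ↦ ?_)
          ((card_union_le _ _).trans (Nat.add_le_add_right (card_union_le _ _) _))
        simp only [mem_union, mem_filter, hx, true_and]
        tauto
      omega
    · refine disjoint_left.2 fun x hx hx' ↦ ?_
      simp only [mem_filter, mem_univ, true_and] at hx hx'
      exact hdisj x hx hx'
    · refine disjoint_left.2 fun x hx hx' ↦ ?_
      simp only [mem_union, mem_filter, mem_univ, true_and] at hx hx'
      tauto
  have hE : ∀ p, ∀ q ∈ B, #{x ∈ B | x - p ∈ H} + #{x ∈ B | x - (p + q) ∈ H} ≤ h := by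
    intro p q hq
    rw [← hcoset (p + q), ← card_vadd_finset q {x ∈ B | x - p ∈ H}, ← card_union_of_disjoint]
    · refine card_le_card fun x hx ↦ ?_
      simp only [mem_union, mem_vadd_finset, mem_filter, mem_univ, true_and, vadd_eq_add] at hx ⊢
      rcases hx with ⟨y, ⟨-, hy⟩, rfl⟩ | hx
      · rwa [add_comm p q, add_sub_add_left_eq_sub]
      · exact hx.2
    · refine disjoint_left.2 fun x hx hx' ↦ ?_
      simp only [mem_vadd_finset, mem_filter, vadd_eq_add] at hx hx'
      obtain ⟨y, ⟨hy, -⟩, rfl⟩ := hx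
      exact hB q hq y hy hx'.1
  have hcongr : ∀ p q, p - q ∈ H → #{x ∈ B | x - p ∈ H} = #{x ∈ B | x - q ∈ H} := by
    intro p q hpq
    congr 1
    refine filter_congr fun x _ ↦ ?_
    rw [← sub_add_sub_cancel x p q, H.add_mem_cancel_right hpq]
  have key : ∀ p ∈ B, ∀ q ∈ B, ∀ r ∈ B, p + q - r ∈ H → q ∈ H := by
    intro p hp q hq r hr hpqr
    have h1 := hE p q hq
    rw [hcongr _ _ hpqr] at h1
    by_contra hqH
    have h2 := hD p hp r hr fun hpr ↦ hqH (by
      have := H.sub_mem hpqr hpr; rwa [show p + q - r - (p - r) = q by abel] at this)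
    omega
  rintro _ hp _ hq hr
  simp only [coe_image, Set.mem_image, mem_coe] at hp hq hr
  obtain ⟨p, hp, rfl⟩ := hp
  obtain ⟨q, hq, rfl⟩ := hq
  obtain ⟨r, hr, hr'⟩ := hr
  rw [← map_add, eq_comm, ← sub_eq_zero, ← map_sub] at hr'
  have hr' : p + q - r ∈ H := (QuotientAddGroup.eq_zero_iff _).1 hr'
  have hpH := key q hq p hp r hr (by rwa [add_comm q p])
  have hBH : ∀ y ∈ B, y ∈ H := by
    intro y hy
    by_contra hyH
    have h1 := hE p y hy
    rw [hcongr (p + y) y (by simpa)] at h1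
    have h2 := hD p hp y hy fun h' ↦ hyH (by
      have := H.sub_mem hpH h'; rwa [sub_sub_cancel] at this)
    omega
  have h1 : ({x | ∃ b ∈ B, x - b ∈ H} : Finset G) = ({x | x ∈ H} : Finset G) := by
    ext x
    simp only [mem_filter, mem_univ, true_and]
    refine ⟨fun ⟨b, hb, hx⟩ ↦ by simpa using H.add_mem hx (hBH b hb), fun hx ↦
      ⟨p, hp, H.sub_mem hx hpH⟩⟩
  rw [h1] at hu
  obtain ⟨g, hg⟩ : ∃ g, g ∉ H := by
    by_contra! hcon
    exact hu (by ext; simp [hcon])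
  have h2 : 2 * h ≤ Fintype.card G := by
    have h3 : ({x | x ∈ H} : Finset G) ∪ ({x | x - g ∈ H} : Finset G) ⊆ univ := subset_univ _
    have := card_le_card h3
    rw [card_union_of_disjoint, hcoset, card_univ] at this
    · omega
    · refine disjoint_left.2 fun x hx hx' ↦ ?_
      simp only [mem_filter, mem_univ, true_and] at hx hx'
      exact hg (by have := H.sub_mem hx hx'; rwa [sub_sub_cancel] at this)
  have h3 := hE p p hp
  rw [hcongr (p + p) p (by simpa), filter_true_of_mem fun x hx ↦ H.sub_mem (hBH x hx) hpH] at h3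
  omega

/-- Sum-free sets of density above `0.37` in groups of odd order are pulled back from `ZMod 5`. -/
lemma exists_hom_of_large_sumFree {G : Type*} [AddCommGroup G] [Fintype G]
    (hodd : Odd (Fintype.card G)) {B : Finset G} (hB : IsSumFree (B : Set G))
    (hd : 37 * Fintype.card G < 100 * #B) : ∃ φ : G →+ ZMod 5, B ⊆ outerClasses φ := by
  induction hN : Fintype.card G using Nat.strong_induction_on generalizing G with
  | _ N ih =>
  have hBne : B.Nonempty := card_pos.1 (by omega)
  have hdisj : Disjoint (B + B) B := disjoint_left.2 fun x hx hx' ↦ by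
    obtain ⟨y, hy, z, hz, rfl⟩ := mem_add.1 hx
    exact hB y hy z hz hx'
  have hsum : #(B + B) + #B ≤ Fintype.card G := by
    rw [← card_union_of_disjoint hdisj]; exact card_le_univ _
  by_cases hcase : #(B + B) + 1 < 2 * #B
  · obtain ⟨H, hu, hc⟩ := exists_addSubgroup_of_card_add_lt (fun h ↦ by
      rw [h, card_univ] at hsum; have := card_pos.2 hBne; omega) hcase
    have hsf := isSumFree_image_mk hB hu hc (by omega)
    have hle : #B ≤ #{x | ∃ b ∈ B, x - b ∈ H} :=
      card_le_card fun x hx ↦ by simpa using ⟨x, hx, by simp⟩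
    have hcH : #({x | x ∈ H} : Finset G) = Nat.card H := by
      rw [Nat.card_eq_fintype_card, Fintype.card_subtype]
    have hmul : Fintype.card (G ⧸ H) * Nat.card H = Fintype.card G := by
      rw [← Nat.card_eq_fintype_card, ← Nat.card_eq_fintype_card,
        ← AddSubgroup.card_eq_card_quotient_mul_card_addSubgroup]
    have hfib : #B ≤ Nat.card H * #(B.image (QuotientAddGroup.mk' H)) := by
      refine card_le_mul_card_image _ _ fun b hb ↦ ?_
      obtain ⟨p, hp, rfl⟩ := mem_image.1 hb
      rw [← hcH, ← card_vadd_finset p ({x | x ∈ H} : Finset G)]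
      refine card_le_card fun x hx ↦ mem_vadd_finset.2 ⟨x - p, ?_, by simp⟩
      rw [mem_filter, ← sub_eq_zero, ← map_sub] at hx
      simpa using (QuotientAddGroup.eq_zero_iff _).1 hx.2
    have hh2 : 2 ≤ Nat.card H := by omega
    have hQ : 0 < Fintype.card (G ⧸ H) := Fintype.card_pos
    obtain ⟨φ, hφ⟩ := ih (Fintype.card (G ⧸ H)) (by nlinarith)
      (Nat.Odd.of_mul_left (hmul ▸ hodd)) (B := B.image (QuotientAddGroup.mk' H))
      hsf (by
        by_contra! hcon
        have := Nat.mul_le_mul_left (Nat.card H) hcon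
        nlinarith) rfl
    refine ⟨φ.comp (QuotientAddGroup.mk' H), fun x hx ↦ ?_⟩
    have := hφ (mem_image_of_mem _ hx)
    rw [mem_outerClasses] at this ⊢
    exact this
  · refine exists_hom_of_card_eq_five hB hBne ?_
    obtain ⟨k, hk⟩ := hodd
    have : k ≤ 4 := by omega
    interval_cases k <;> omega

end Stability

section Removal

variable {G : Type*} [AddCommGroup G]

/-- The pairs `(x, y)` in `F × F` with `x + y ∈ F`. -/
noncomputable def schurPairs (F : Finset G) : Finset (G × G) := {p ∈ F ×ˢ F | p.1 + p.2 ∈ F}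

lemma mem_schurPairs {F : Finset G} {x y : G} :
    (x, y) ∈ schurPairs F ↔ x ∈ F ∧ y ∈ F ∧ x + y ∈ F := by
  simp [schurPairs, and_assoc]

variable [Fintype G]

open SimpleGraph TripartiteFromTriangles in
lemma card_schurPairs_ge {F : Finset G} {T : Finset (G × G)} (hT : T ⊆ schurPairs F)
    (h1 : Set.InjOn (fun p : G × G ↦ p.1) T) (h2 : Set.InjOn (fun p : G × G ↦ p.2) T)
    (h3 : Set.InjOn (fun p : G × G ↦ p.1 + p.2) T) {ε : ℝ}
    (hε : ε * Fintype.card G ≤ 3 * #T) :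
    triangleRemovalBound (ε / 27) * 27 * (Fintype.card G : ℝ) ^ 2 ≤ #(schurPairs F) := by
  set N := Fintype.card G with hN
  have hNpos : (0 : ℝ) < N := by rw [hN]; exact_mod_cast Fintype.card_pos
  let f : G × G × G → G × G × G := fun q ↦ (q.1, q.1 + q.2.1, q.1 + q.2.1 + q.2.2)
  have hf : Function.Injective f := by
    rintro ⟨a, b, c⟩ ⟨a', b', c'⟩ h
    simp only [f, Prod.mk.injEq] at h
    obtain ⟨rfl, h, h'⟩ := h
    obtain rfl := add_left_cancel h
    rw [add_left_cancel h']
  set t := ((univ : Finset G) ×ˢ T).image f with ht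
  have hmem : ∀ a b c, (a, b, c) ∈ t ↔ (b - a, c - b) ∈ T := by
    intro a b c
    simp only [ht, mem_image, mem_product, mem_univ, true_and, f, Prod.mk.injEq]
    constructor
    · rintro ⟨⟨g, x, y⟩, h, rfl, rfl, rfl⟩
      simpa [add_sub_cancel_left] using h
    · intro h
      exact ⟨(a, b - a, c - b), h, rfl, by simp, by simp⟩
  have hcard : #t = N * #T := by
    rw [ht, card_image_of_injective _ hf, card_product, card_univ]
  have : ExplicitDisjoint t := by
    refine ⟨fun {a b c a'} h h' ↦ ?_, fun {a b c b'} h h' ↦ ?_, fun {a b c c'} h h' ↦ ?_⟩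
    all_goals rw [hmem] at h h'
    · have := congrArg Prod.fst (h2 h h' rfl)
      exact (sub_right_injective this)
    · have := congrArg Prod.fst (h3 h h' (by simp))
      exact (sub_left_injective this)
    · have := congrArg Prod.snd (h1 h h' rfl)
      exact (sub_left_injective this)
  have hfar : (graph t).FarFromTriangleFree (ε / 27) := by
    refine farFromTriangleFree t ?_
    rw [hcard]
    push_cast
    nlinarith
  have hle := hfar.le_card_cliqueFinset
  have hsub : (graph t).cliqueFinset 3 ⊆
      ((univ : Finset G) ×ˢ schurPairs F).image fun q ↦ toTriangle (f q) := by
    intro s hs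
    rw [mem_cliqueFinset_iff, is3Clique_iff] at hs
    obtain ⟨x, y, z, hxy, hxz, hyz, rfl⟩ := hs
    obtain ⟨a, b, c, h, hab, hac, hbc⟩ := graph_triple hxy hxz hyz
    rw [← h, mem_image]
    rw [Graph.in₀₁_iff] at hab
    rw [Graph.in₀₂_iff] at hac
    rw [Graph.in₁₂_iff] at hbc
    obtain ⟨c', hab⟩ := hab
    obtain ⟨b', hac⟩ := hac
    obtain ⟨a', hbc⟩ := hbc
    rw [hmem] at hab hac hbc
    have hab := mem_schurPairs.1 (hT hab)
    have hac := mem_schurPairs.1 (hT hac)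
    have hbc := mem_schurPairs.1 (hT hbc)
    refine ⟨(a, b - a, c - b), ?_, ?_⟩
    · simp only [mem_product, mem_univ, true_and, mem_schurPairs]
      refine ⟨hab.1, hbc.2.1, ?_⟩
      have := hac.2.2
      rwa [show b' - a + (c - b') = b - a + (c - b) by abel] at this
    · rw [show f (a, b - a, c - b) = (a, b, c) by simp [f], toTriangle_apply]
  have hle2 := (card_le_card hsub).trans card_image_le
  rw [card_product, card_univ, ← hN] at hle2
  have hle2 : (#((graph t).cliqueFinset 3) : ℝ) ≤ N * #(schurPairs F) := by exact_mod_cast hle2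
  have hle3 := hle.trans hle2
  simp only [Fintype.card_sum, ← hN] at hle3
  push_cast at hle3
  refine le_of_mul_le_mul_left (a := (N : ℝ)) ?_ hNpos
  refine le_trans (le_of_eq ?_) hle3
  ring

/-- The removal lemma for sum-free sets. -/
lemma exists_sumFree_subset_of_card_schurPairs_lt {F : Finset G} {ε : ℝ}
    (h : (#(schurPairs F) : ℝ) <
      SimpleGraph.triangleRemovalBound (ε / 27) * 27 * (Fintype.card G : ℝ) ^ 2) :
    ∃ B ⊆ F, IsSumFree (B : Set G) ∧ (#(F \ B) : ℝ) ≤ ε * Fintype.card G := by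
  let P : Finset (G × G) → Prop := fun T ↦ Set.InjOn (fun p : G × G ↦ p.1) T ∧
    Set.InjOn (fun p : G × G ↦ p.2) T ∧ Set.InjOn (fun p : G × G ↦ p.1 + p.2) T
  obtain ⟨T, hT, hmax⟩ := exists_max_image {T ∈ (schurPairs F).powerset | P T} card
    ⟨∅, by simp [P]⟩
  rw [mem_filter, mem_powerset] at hT
  obtain ⟨hTF, h1, h2, h3⟩ := hT
  set R := T.image (fun p ↦ p.1) ∪ T.image (fun p ↦ p.2) ∪ T.image (fun p ↦ p.1 + p.2) with hR
  have hR3 : #R ≤ 3 * #T := by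
    have e1 := card_union_le (T.image (fun p ↦ p.1) ∪ T.image (fun p ↦ p.2))
      (T.image (fun p ↦ p.1 + p.2))
    have e2 := card_union_le (T.image (fun p ↦ p.1)) (T.image (fun p ↦ p.2))
    have e3 : #(T.image (fun p ↦ p.1)) ≤ #T := card_image_le
    have e4 : #(T.image (fun p ↦ p.2)) ≤ #T := card_image_le
    have e5 : #(T.image (fun p ↦ p.1 + p.2)) ≤ #T := card_image_le
    rw [hR]
    omega
  have hT3 : (3 * #T : ℝ) ≤ ε * Fintype.card G := by
    by_contra! hcon
    exact absurd (card_schurPairs_ge hTF h1 h2 h3 hcon.le) (not_le.2 h)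
  refine ⟨F \ R, sdiff_subset, ?_, ?_⟩
  · intro x hx y hy hxy
    rw [mem_coe, mem_sdiff] at hx hy hxy
    simp only [hR, mem_union, mem_image, not_or, not_exists, not_and] at hx hy hxy
    have hxT : (x, y) ∉ T := fun hmem ↦ hx.2.1.1 _ hmem rfl
    have := hmax (insert (x, y) T) (by
      rw [mem_filter, mem_powerset, insert_subset_iff, mem_schurPairs]
      refine ⟨⟨⟨hx.1, hy.1, hxy.1⟩, hTF⟩, ?_⟩
      simp only [P, coe_insert]
      refine ⟨(Set.injOn_insert hxT).2 ⟨h1, ?_⟩, (Set.injOn_insert hxT).2 ⟨h2, ?_⟩,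
        (Set.injOn_insert hxT).2 ⟨h3, ?_⟩⟩
      · rintro ⟨p, hp, hpx⟩; exact hx.2.1.1 p hp hpx
      · rintro ⟨p, hp, hpx⟩; exact hy.2.1.2 p hp hpx
      · rintro ⟨p, hp, hpx⟩; exact hxy.2.2 p hp hpx)
    rw [card_insert_of_notMem hxT] at this
    omega
  · refine le_trans ?_ hT3
    have : #(F \ (F \ R)) ≤ #R := card_le_card fun x hx ↦ by
      simp only [mem_sdiff] at hx; tauto
    exact_mod_cast this.trans hR3

end Removal

section GraphContainers

variable {V : Type*} [Fintype V]

/-- Kleitman–Winston: the independent sets of a graph are covered by few sets inducing subgraphs of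
small maximum degree. -/
lemma exists_lowDegree_containers (Γ : SimpleGraph V) {d : ℕ} {r : ℝ} (hr : 1 ≤ r)
    (hd : r ^ (d + 1) + 1 ≤ r ^ (d + 2)) (F : Finset V) :
    ∃ 𝓕 : Finset (Finset V), (#𝓕 : ℝ) ≤ r ^ #F ∧
      (∀ K ∈ 𝓕, K ⊆ F ∧ ∀ v ∈ K, #{w ∈ K | Γ.Adj v w} ≤ d) ∧
      ∀ A ⊆ F, (∀ x ∈ A, ∀ y ∈ A, ¬ Γ.Adj x y) → ∃ K ∈ 𝓕, A ⊆ K := by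
  induction hF : #F using Nat.strong_induction_on generalizing F with
  | _ f ih =>
  subst hF
  by_cases hmax : ∀ v ∈ F, #{w ∈ F | Γ.Adj v w} ≤ d
  · refine ⟨{F}, ?_, ?_, fun A hA _ ↦ ⟨F, mem_singleton_self _, hA⟩⟩
    · rw [card_singleton, Nat.cast_one]; exact one_le_pow₀ hr
    · intro K hK
      rw [mem_singleton] at hK
      subst hK
      exact ⟨subset_rfl, hmax⟩
  push Not at hmax
  obtain ⟨v, hv, hdeg⟩ := hmax
  set L : Finset V := {w ∈ F | ¬ Γ.Adj v w} with hL
  have hvL : v ∈ L := by simp [hL, hv]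
  have hLc : #(L.erase v) + d + 2 ≤ #F := by
    have h1 := card_erase_add_one hvL
    have h2 := card_filter_add_card_filter_not (s := F) (fun w ↦ Γ.Adj v w)
    rw [← hL] at h2
    omega
  have hFc := card_erase_add_one hv
  obtain ⟨𝓕₁, h1c, h1d, h1A⟩ := ih #(F.erase v) (by omega) (F.erase v) rfl
  obtain ⟨𝓕₂, h2c, h2d, h2A⟩ := ih #(L.erase v) (by omega) (L.erase v) rfl
  refine ⟨𝓕₁ ∪ 𝓕₂.image (insert v), ?_, ?_, ?_⟩
  · have e1 : (#(𝓕₁ ∪ 𝓕₂.image (insert v)) : ℝ) ≤ #𝓕₁ + #𝓕₂ := by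
      exact_mod_cast (card_union_le _ _).trans (Nat.add_le_add_left card_image_le _)
    have e2 : r ^ #(L.erase v) ≤ r ^ (#F - d - 2) := pow_le_pow_right₀ hr (by omega)
    have e3 : r ^ #F = r ^ (#F - d - 2) * r ^ (d + 2) := by rw [← pow_add]; congr 1; omega
    have e4 : r ^ #(F.erase v) = r ^ (#F - d - 2) * r ^ (d + 1) := by
      rw [← pow_add]; congr 1; omega
    have e5 : 0 ≤ r ^ (#F - d - 2) := by positivity
    rw [e4] at h1c
    rw [e3]
    nlinarith
  · intro K hK
    rw [mem_union, mem_image] at hK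
    rcases hK with hK | ⟨K, hK, rfl⟩
    · exact ⟨(h1d K hK).1.trans (erase_subset _ _), (h1d K hK).2⟩
    · have hKL := (h2d K hK).1
      have hKv : ∀ w ∈ K, ¬ Γ.Adj v w := fun w hw ↦ (mem_filter.1 (mem_of_mem_erase (hKL hw))).2
      refine ⟨insert_subset hv ((hKL.trans (erase_subset _ _)).trans (filter_subset _ _)), ?_⟩
      intro w hw
      rw [mem_insert] at hw
      rcases hw with rfl | hw
      · rw [filter_insert, if_neg (Γ.irrefl), filter_false_of_mem hKv, card_empty]
        exact Nat.zero_le _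
      · rw [filter_insert, if_neg fun h ↦ hKv w hw h.symm]
        exact (h2d K hK).2 w hw
  · intro A hA hAi
    by_cases hvA : v ∈ A
    · obtain ⟨K, hK, hAK⟩ := h2A (A.erase v) (fun x hx ↦ by
        rw [mem_erase] at hx ⊢
        exact ⟨hx.1, mem_filter.2 ⟨hA hx.2, hAi v hvA x hx.2⟩⟩) fun x hx y hy ↦
          hAi x (mem_of_mem_erase hx) y (mem_of_mem_erase hy)
      exact ⟨insert v K, mem_union_right _ (mem_image_of_mem _ hK), by
        rwa [← insert_erase hvA, insert_subset_insert_iff (notMem_erase v A)] ⟩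
    · obtain ⟨K, hK, hAK⟩ := h1A A (subset_erase.2 ⟨hA, hvA⟩) hAi
      exact ⟨K, mem_union_left _ hK, hAK⟩

end GraphContainers

section SumFreeContainers

variable {G : Type*} [AddCommGroup G] [Fintype G]

lemma card_schurPairs_le_of_popular (F : Finset G) {δ : ℝ} (hδ : 0 < δ)
    (hF : δ * (Fintype.card G : ℝ) ^ 2 < #(schurPairs F)) :
    δ / 2 * Fintype.card G ≤
      #{s ∈ F | δ / 2 * Fintype.card G ≤ (#{x ∈ F | x + s ∈ F} : ℝ)} := by
  set N : ℝ := (Fintype.card G : ℝ) with hN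
  have hNpos : 0 < N := by rw [hN]; exact_mod_cast Fintype.card_pos
  set D : Finset G := {s ∈ F | δ / 2 * N ≤ (#{x ∈ F | x + s ∈ F} : ℝ)} with hD
  have hle : ∀ T : Finset G, (#T : ℝ) ≤ N := fun T ↦ by rw [hN]; exact_mod_cast card_le_univ T
  have hsum : (#(schurPairs F) : ℝ) = ∑ s ∈ F, (#{x ∈ F | x + s ∈ F} : ℝ) := by
    have : #(schurPairs F) = ∑ s ∈ F, #{x ∈ F | x + s ∈ F} := by
      rw [card_eq_sum_card_fiberwise (f := Prod.snd) (t := F) fun p hp ↦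
        (mem_schurPairs.1 hp).2.1]
      refine sum_congr rfl fun s hs ↦ ?_
      refine card_bij' (fun p _ ↦ p.1) (fun x _ ↦ (x, s)) ?_ ?_ ?_ ?_
      · rintro ⟨x, y⟩ h
        rw [mem_filter, mem_schurPairs] at h
        obtain ⟨⟨h1, h2, h3⟩, rfl⟩ := h
        exact mem_filter.2 ⟨h1, h3⟩
      · intro x h
        rw [mem_filter] at h
        rw [mem_filter, mem_schurPairs]
        exact ⟨⟨h.1, hs, h.2⟩, rfl⟩
      · rintro ⟨x, y⟩ h
        rw [mem_filter] at h
        rw [← h.2]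
      · intro x h; rfl
    exact_mod_cast this
  have hbound : ∑ s ∈ F, (#{x ∈ F | x + s ∈ F} : ℝ) ≤
      ∑ s ∈ F, ((if s ∈ D then N else 0) + δ / 2 * N) := by
    refine sum_le_sum fun s hs ↦ ?_
    by_cases h : s ∈ D
    · rw [if_pos h]
      have := hle {x ∈ F | x + s ∈ F}
      have : 0 < δ / 2 * N := by positivity
      linarith
    · rw [if_neg h, zero_add]
      by_contra! hcon
      exact h (mem_filter.2 ⟨hs, hcon.le⟩)
  rw [sum_add_distrib, sum_ite_mem, sum_const, sum_const, nsmul_eq_mul, nsmul_eq_mul,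
    inter_eq_right.2 (filter_subset _ _)] at hbound
  have h1 : (#F : ℝ) * (δ / 2 * N) ≤ N * (δ / 2 * N) :=
    mul_le_mul_of_nonneg_right (hle F) (by positivity)
  by_contra! hcon
  have h2 : (#D : ℝ) * N < δ / 2 * N * N := mul_lt_mul_of_pos_right hcon hNpos
  nlinarith

lemma card_sdiff_ge_of_lowDegree {F K S : Finset G} {d : ℕ} {δ : ℝ}
    (hS0 : (0 : G) ∉ S)
    (hS : ∀ s ∈ S, δ / 2 * Fintype.card G ≤ (#{x ∈ F | x + s ∈ F} : ℝ))
    (hd : ∀ v ∈ K, #{w ∈ K | (linkGraph S).Adj v w} ≤ d)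
    (hk : 4 * d ≤ δ * #S) (hSne : 0 < #S) : δ / 8 * Fintype.card G ≤ (#(F \ K) : ℝ) := by
  set N : ℝ := (Fintype.card G : ℝ) with hN
  have hdeg : ∀ x ∈ K, #{s ∈ S | x + s ∈ K} ≤ d := fun x hx ↦ by
    refine le_trans ?_ (hd x hx)
    refine card_le_card_of_injOn (fun s ↦ x + s) ?_ fun s _ t _ h ↦ add_left_cancel h
    intro s hs
    rw [mem_coe, mem_filter] at hs ⊢
    refine ⟨hs.2, ?_⟩
    exact ⟨fun h ↦ hS0 (left_eq_add.1 h ▸ hs.1), s, hs.1, Or.inr (Or.inl rfl)⟩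
  have hpt : ∀ s ∈ S, #{x ∈ F | x + s ∈ F} ≤
      #{x ∈ K | x + s ∈ K} + 2 * #(F \ K) := by
    intro s _
    have h1 : {x ∈ F | x + s ∈ F} ⊆
        {x ∈ K | x + s ∈ K} ∪ (F \ K ∪ (F \ K).image fun x ↦ x - s) := by
      intro x hx
      simp only [mem_filter, mem_union, mem_sdiff, mem_image] at hx ⊢
      by_cases h1 : x ∈ K
      · by_cases h2 : x + s ∈ K
        · exact Or.inl ⟨h1, h2⟩
        · exact Or.inr (Or.inr ⟨x + s, ⟨hx.2, h2⟩, by simp⟩)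
      · exact Or.inr (Or.inl ⟨hx.1, h1⟩)
    have h2 := card_le_card h1
    have h3 := card_union_le {x ∈ K | x + s ∈ K} (F \ K ∪ (F \ K).image fun x ↦ x - s)
    have h4 := card_union_le (F \ K) ((F \ K).image fun x ↦ x - s)
    have h5 : #((F \ K).image fun x ↦ x - s) ≤ #(F \ K) := card_image_le
    omega
  have hdouble : ∑ s ∈ S, #{x ∈ K | x + s ∈ K} = ∑ x ∈ K, #{s ∈ S | x + s ∈ K} := by
    simp only [card_filter]
    exact sum_comm
  have hA : ∑ s ∈ S, #{x ∈ F | x + s ∈ F} ≤ #K * d + #S * (2 * #(F \ K)) := by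
    refine (sum_le_sum hpt).trans ?_
    rw [sum_add_distrib, hdouble, sum_const, smul_eq_mul]
    exact Nat.add_le_add_right (sum_le_card_nsmul _ _ _ hdeg) _
  have hB : (#S : ℝ) * (δ / 2 * N) ≤ ∑ s ∈ S, (#{x ∈ F | x + s ∈ F} : ℝ) := by
    rw [← nsmul_eq_mul]; exact card_nsmul_le_sum _ _ _ hS
  have hA' : ∑ s ∈ S, (#{x ∈ F | x + s ∈ F} : ℝ) ≤ #K * d + #S * (2 * #(F \ K)) := by
    exact_mod_cast hA
  have hKN : (#K : ℝ) ≤ N := by rw [hN]; exact_mod_cast card_le_univ K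
  have hKd : (#K : ℝ) * d ≤ N * (δ * #S / 4) := by
    have : (d : ℝ) ≤ δ * #S / 4 := by linarith
    gcongr
  have hSpos : (0 : ℝ) < #S := by exact_mod_cast hSne
  refine le_of_mul_le_mul_left (a := (#S : ℝ)) ?_ hSpos
  nlinarith

end SumFreeContainers

section SumFreeContainers

variable {G : Type*} [AddCommGroup G] [Fintype G]

lemma exists_smaller_containers {F : Finset G} {d k : ℕ} {δ r : ℝ} (hδ : 0 < δ) (hr : 1 ≤ r)
    (hd : r ^ (d + 1) + 1 ≤ r ^ (d + 2)) (hk : 4 * d ≤ δ * k) (hk0 : 0 < k)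
    (hkδ : k ≤ 3 / 8 * δ * Fintype.card G) (hkG : k ≤ Fintype.card G)
    (hF : δ * (Fintype.card G : ℝ) ^ 2 < #(schurPairs F)) :
    ∃ 𝓕 : Finset (Finset G),
      (#𝓕 : ℝ) ≤ (Fintype.card G : ℝ) ^ k * (1 + r ^ Fintype.card G) ∧
      (∀ K ∈ 𝓕, #K + δ / 8 * Fintype.card G ≤ (#F : ℝ)) ∧
      ∀ A ⊆ F, IsSumFree (A : Set G) → ∃ K ∈ 𝓕, A ⊆ K := by
  set N : ℝ := (Fintype.card G : ℝ) with hN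
  have hD := card_schurPairs_le_of_popular F hδ hF
  set D : Finset G := {s ∈ F | δ / 2 * N ≤ (#{x ∈ F | x + s ∈ F} : ℝ)} with hDdef
  choose 𝓚 h𝓚c h𝓚d h𝓚A using fun S : Finset G ↦ exists_lowDegree_containers (linkGraph S) hr hd F
  refine ⟨{K ∈ (powersetCard k (univ : Finset G)).biUnion fun S ↦ insert (F \ D ∪ S) (𝓚 S) |
    #K + δ / 8 * N ≤ (#F : ℝ)}, ?_, fun K hK ↦ (mem_filter.1 hK).2, ?_⟩
  · have h1 : ∀ S, (#(insert (F \ D ∪ S) (𝓚 S)) : ℝ) ≤ 1 + r ^ Fintype.card G := by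
      intro S
      have h2 : (#(insert (F \ D ∪ S) (𝓚 S)) : ℝ) ≤ #(𝓚 S) + 1 := by
        exact_mod_cast card_insert_le _ _
      have h3 : r ^ #F ≤ r ^ Fintype.card G := pow_le_pow_right₀ hr (card_le_univ F)
      linarith [h𝓚c S]
    have h2 : (#(powersetCard k (univ : Finset G)) : ℝ) ≤ N ^ k := by
      rw [card_powersetCard, card_univ, hN]
      exact_mod_cast Nat.choose_le_pow _ _
    have h3 : (#((powersetCard k (univ : Finset G)).biUnion
        fun S ↦ insert (F \ D ∪ S) (𝓚 S)) : ℝ) ≤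
        ∑ S ∈ powersetCard k (univ : Finset G), (#(insert (F \ D ∪ S) (𝓚 S)) : ℝ) := by
      exact_mod_cast card_biUnion_le
    refine le_trans (Nat.cast_le.2 (card_filter_le _ _)) (h3.trans ?_)
    refine (sum_le_card_nsmul _ _ _ fun S _ ↦ h1 S).trans ?_
    rw [nsmul_eq_mul]
    have : 0 ≤ r := by linarith
    gcongr
  · intro A hAF hA
    by_cases hAD : #(A ∩ D) < k
    · obtain ⟨S, hAS, hSk⟩ := exists_superset_card_eq hAD.le hkG
      refine ⟨F \ D ∪ S, mem_filter.2 ⟨mem_biUnion.2 ⟨S, ?_, mem_insert_self _ _⟩, ?_⟩, ?_⟩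
      · exact mem_powersetCard.2 ⟨subset_univ _, hSk⟩
      · have h1 : (#(F \ D ∪ S) : ℝ) ≤ #(F \ D) + #S := by exact_mod_cast card_union_le _ _
        have h2 : (#(F \ D) : ℝ) + #D = #F := by
          exact_mod_cast card_sdiff_add_card_eq_card (filter_subset _ _)
        rw [hSk] at h1
        linarith
      · intro x hx
        rw [mem_union, mem_sdiff]
        by_cases hxD : x ∈ D
        · exact Or.inr (hAS (mem_inter.2 ⟨hx, hxD⟩))
        · exact Or.inl ⟨hAF hx, hxD⟩
    · obtain ⟨S, hSA, hSk⟩ := exists_subset_card_eq (not_lt.1 hAD)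
      have hSA' : S ⊆ A := hSA.trans inter_subset_left
      have hSD : S ⊆ D := hSA.trans inter_subset_right
      obtain ⟨K, hK, hAK⟩ := h𝓚A S A hAF fun x hx y hy ⟨_, s, hs, h⟩ ↦ by
        have hs := hSA' hs
        rcases h with h | h | h
        · exact hA x hx y hy (h ▸ hs)
        · exact hA x hx s hs (h ▸ hy)
        · exact hA y hy s hs (h ▸ hx)
      refine ⟨K, mem_filter.2 ⟨mem_biUnion.2 ⟨S, ?_, mem_insert_of_mem hK⟩, ?_⟩, hAK⟩
      · exact mem_powersetCard.2 ⟨subset_univ _, hSk⟩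
      · have h1 := card_sdiff_ge_of_lowDegree (F := F) (K := K) (S := S) (d := d) (δ := δ)
          (fun h ↦ hA.zero_notMem (hSA' h)) (fun s hs ↦ (mem_filter.1 (hSD hs)).2)
          (h𝓚d S K hK).2 (by rwa [hSk]) (by rwa [hSk])
        have h2 : (#(F \ K) : ℝ) + #K = #F := by
          exact_mod_cast card_sdiff_add_card_eq_card (h𝓚d S K hK).1
        linarith

lemma exists_containers_of_card_le {d k : ℕ} {δ r : ℝ} (hδ : 0 < δ) (hr : 1 ≤ r)
    (hd : r ^ (d + 1) + 1 ≤ r ^ (d + 2)) (hk : 4 * d ≤ δ * k) (hk0 : 0 < k)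
    (hkδ : k ≤ 3 / 8 * δ * Fintype.card G) (hkG : k ≤ Fintype.card G) (j : ℕ) (F : Finset G)
    (hF : (#F : ℝ) ≤ j * (δ / 8 * Fintype.card G)) :
    ∃ 𝓕 : Finset (Finset G),
      (#𝓕 : ℝ) ≤ ((Fintype.card G : ℝ) ^ k * (1 + r ^ Fintype.card G)) ^ j ∧
      (∀ K ∈ 𝓕, (#(schurPairs K) : ℝ) ≤ δ * (Fintype.card G : ℝ) ^ 2) ∧
      ∀ A ⊆ F, IsSumFree (A : Set G) → ∃ K ∈ 𝓕, A ⊆ K := by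
  have hN : (1 : ℝ) ≤ Fintype.card G := by exact_mod_cast Fintype.card_pos
  set Q := (Fintype.card G : ℝ) ^ k * (1 + r ^ Fintype.card G) with hQ
  have hQ1 : 1 ≤ Q := one_le_mul_of_one_le_of_one_le (one_le_pow₀ hN)
    (by have := one_le_pow₀ hr (n := Fintype.card G); linarith)
  have htriv : ∀ (j : ℕ) (F : Finset G),
      (#(schurPairs F) : ℝ) ≤ δ * (Fintype.card G : ℝ) ^ 2 → ∃ 𝓕 : Finset (Finset G),
      (#𝓕 : ℝ) ≤ Q ^ j ∧
      (∀ K ∈ 𝓕, (#(schurPairs K) : ℝ) ≤ δ * (Fintype.card G : ℝ) ^ 2) ∧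
      ∀ A ⊆ F, IsSumFree (A : Set G) → ∃ K ∈ 𝓕, A ⊆ K := by
    intro j F hS
    refine ⟨{F}, ?_, fun K hK ↦ ?_, fun A hA _ ↦ ⟨F, mem_singleton_self _, hA⟩⟩
    · rw [card_singleton, Nat.cast_one]; exact one_le_pow₀ hQ1
    · rwa [mem_singleton.1 hK]
  induction j generalizing F with
  | zero =>
    have : #F = 0 := by rw [Nat.cast_zero, zero_mul] at hF; exact_mod_cast hF.antisymm (by simp)
    rw [card_eq_zero] at this
    subst this
    refine htriv 0 ∅ ?_
    have h1 : schurPairs (∅ : Finset G) = ∅ := by simp [schurPairs]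
    rw [h1, card_empty, Nat.cast_zero]
    positivity
  | succ j ih =>
    by_cases hS : (#(schurPairs F) : ℝ) ≤ δ * (Fintype.card G : ℝ) ^ 2
    · exact htriv _ F hS
    rw [not_le] at hS
    obtain ⟨𝓕, hc, hs, hA⟩ := exists_smaller_containers hδ hr hd hk hk0 hkδ hkG hS
    rw [← hQ] at hc
    have hstep : ∀ K ∈ 𝓕, (#K : ℝ) ≤ j * (δ / 8 * Fintype.card G) := fun K hK ↦ by
      have := hs K hK
      push_cast at hF
      linarith
    choose! 𝓢 h𝓢c h𝓢s h𝓢A using fun K hK ↦ ih K (hstep K hK)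
    refine ⟨𝓕.biUnion 𝓢, ?_, ?_, ?_⟩
    · have h1 : (#(𝓕.biUnion 𝓢) : ℝ) ≤ ∑ K ∈ 𝓕, (#(𝓢 K) : ℝ) := by exact_mod_cast card_biUnion_le
      refine h1.trans ((sum_le_card_nsmul _ _ _ h𝓢c).trans ?_)
      rw [nsmul_eq_mul, pow_succ']
      gcongr
    · intro K hK
      obtain ⟨K', hK', hK⟩ := mem_biUnion.1 hK
      exact h𝓢s K' hK' K hK
    · intro A hAF hAs
      obtain ⟨K, hK, hAK⟩ := hA A hAF hAs
      obtain ⟨L, hL, hAL⟩ := h𝓢A K hK A hAK hAs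
      exact ⟨L, mem_biUnion.2 ⟨K, hK, hL⟩, hAL⟩

end SumFreeContainers

section Containers

open Filter

lemma exists_pow_add_one_le {r : ℝ} (hr : 1 < r) : ∃ d : ℕ, r ^ (d + 1) + 1 ≤ r ^ (d + 2) := by
  obtain ⟨d, hd⟩ := pow_unbounded_of_one_lt (1 / (r - 1)) hr
  refine ⟨d, ?_⟩
  have h0 : 0 < r - 1 := by linarith
  rw [div_lt_iff₀ h0] at hd
  have h1 : r ^ d ≤ r ^ (d + 1) := pow_le_pow_right₀ hr.le (by omega)
  have h2 : r ^ d * (r - 1) ≤ r ^ (d + 1) * (r - 1) := mul_le_mul_of_nonneg_right h1 h0.le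
  rw [show r ^ (d + 2) = r ^ (d + 1) * r by ring]
  linarith

lemma eventually_pow_mul_le {ε : ℝ} (hε : 0 < ε) (k j : ℕ) :
    ∀ᶠ N : ℕ in atTop, ((N : ℝ) ^ k * 2) ^ j ≤ 2 ^ (ε * N) := by
  have hr : (1 : ℝ) < 2 ^ ε := Real.one_lt_rpow (by norm_num) hε
  have h := (isLittleO_pow_const_const_pow_of_one_lt (R := ℝ) (k * j) hr).bound
    (c := (2 ^ j)⁻¹) (by positivity)
  filter_upwards [h] with N hN
  rw [Real.norm_of_nonneg (by positivity), Real.norm_of_nonneg (by positivity),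
    inv_mul_eq_div, le_div_iff₀ (by positivity)] at hN
  rw [mul_pow, ← pow_mul, Real.rpow_mul (by norm_num), Real.rpow_natCast]
  exact hN

/-- The container theorem for sum-free sets: all sum-free sets are covered by few sets containing
few Schur triples. -/
theorem exists_sumFree_containers {ε δ : ℝ} (hε : 0 < ε) (hδ : 0 < δ) :
    ∃ N₀ : ℕ, ∀ (G : Type*) [AddCommGroup G] [Fintype G], N₀ ≤ Fintype.card G →
      ∃ 𝓕 : Finset (Finset G), (#𝓕 : ℝ) ≤ 2 ^ (ε * Fintype.card G) ∧
        (∀ K ∈ 𝓕, (#(schurPairs K) : ℝ) ≤ δ * (Fintype.card G : ℝ) ^ 2) ∧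
        ∀ A : Finset G, IsSumFree (A : Set G) → ∃ K ∈ 𝓕, A ⊆ K := by
  obtain ⟨j, hj⟩ := exists_nat_ge (8 / δ)
  have hjpos : (0 : ℝ) < j := lt_of_lt_of_le (by positivity) hj
  set r : ℝ := 2 ^ (ε / (2 * j)) with hr
  have hr1 : 1 < r := Real.one_lt_rpow (by norm_num) (by positivity)
  obtain ⟨d, hd⟩ := exists_pow_add_one_le hr1
  obtain ⟨k, hk⟩ := exists_nat_gt (4 * d / δ)
  have hkpos : (0 : ℝ) < k := lt_of_le_of_lt (by positivity) hk
  obtain ⟨N₁, hN₁⟩ := eventually_atTop.1 (eventually_pow_mul_le (half_pos hε) k j)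
  obtain ⟨N₂, hN₂⟩ := exists_nat_ge (k / (3 / 8 * δ))
  refine ⟨max N₁ (max N₂ k), fun G _ _ hG ↦ ?_⟩
  rw [max_le_iff, max_le_iff] at hG
  obtain ⟨hG₁, hG₂, hG₃⟩ := hG
  have hkδ : (k : ℝ) ≤ 3 / 8 * δ * Fintype.card G := by
    have := hN₂.trans (Nat.cast_le.2 hG₂)
    rwa [div_le_iff₀' (by positivity)] at this
  rw [div_le_iff₀ hδ] at hj
  rw [div_lt_iff₀' hδ] at hk
  obtain ⟨𝓕, hc, hs, hA⟩ := exists_containers_of_card_le (G := G) hδ hr1.le hd hk.le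
    (by exact_mod_cast hkpos) hkδ hG₃ j univ (by
      rw [card_univ]
      have : (0 : ℝ) ≤ Fintype.card G := by positivity
      nlinarith)
  refine ⟨𝓕, hc.trans ?_, hs, fun A ↦ hA A (subset_univ A)⟩
  have h1 := hN₁ _ hG₁
  have h2 : 1 + r ^ Fintype.card G ≤ 2 * r ^ Fintype.card G := by
    have := one_le_pow₀ hr1.le (n := Fintype.card G); linarith
  have h3 : (r ^ Fintype.card G) ^ j = 2 ^ (ε / 2 * Fintype.card G) := by
    rw [hr, ← pow_mul, ← Real.rpow_natCast, ← Real.rpow_mul (by norm_num)]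
    push_cast
    congr 1
    field_simp
  calc ((Fintype.card G : ℝ) ^ k * (1 + r ^ Fintype.card G)) ^ j
      ≤ ((Fintype.card G : ℝ) ^ k * (2 * r ^ Fintype.card G)) ^ j := by gcongr
    _ = ((Fintype.card G : ℝ) ^ k * 2) ^ j * (r ^ Fintype.card G) ^ j := by
        rw [← mul_assoc, mul_pow]
    _ ≤ 2 ^ (ε / 2 * Fintype.card G) * 2 ^ (ε / 2 * Fintype.card G) := by
        rw [h3]; gcongr
    _ = 2 ^ (ε * Fintype.card G) := by
        rw [← Real.rpow_add (by norm_num)]; congr 1; ring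

end Containers

section Assembly

variable {G : Type*} [AddCommGroup G] [Fintype G] {n : ℕ}

lemma card_fiber_of_eq_one_or_four (hG : Fintype.card G = 5 * n) {φ : G →+ ZMod 5} {x : G}
    (hx : φ x = 1 ∨ φ x = 4) (i : ZMod 5) : #{x | φ x = i} = n := by
  have hsurj : ∀ i, ∃ g, φ g = i := by
    have h1 : ∃ g, φ g = 1 := by
      rcases hx with hx | hx
      · exact ⟨x, hx⟩
      · exact ⟨-x, by rw [map_neg, hx]; rfl⟩
    obtain ⟨g, hg⟩ := h1
    intro i
    exact ⟨i.val • g, by rw [map_nsmul, hg, nsmul_one, ZMod.natCast_zmod_val]⟩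
  have hfib : ∀ i, #{x | φ x = i} = #{x | φ x = 0} := by
    intro i
    obtain ⟨g, hg⟩ := hsurj i
    rw [← card_vadd_finset g ({x | φ x = 0} : Finset G)]
    congr 1
    ext y
    simp only [mem_vadd_finset, mem_filter, mem_univ, true_and, vadd_eq_add]
    exact ⟨fun hy ↦ ⟨y - g, by rw [map_sub, hy, hg, sub_self], by abel⟩, by
      rintro ⟨z, hz, rfl⟩; rw [map_add, hz, hg, add_zero]⟩
  have hsum := card_eq_sum_card_fiberwise (s := (univ : Finset G)) (f := φ) (t := univ)
    fun _ _ ↦ mem_coe.2 (mem_univ _)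
  rw [sum_congr rfl fun i _ ↦ hfib i, sum_const, card_univ, card_univ, ZMod.card, hG,
    smul_eq_mul] at hsum
  rw [hfib]
  omega

lemma card_maxSumFree_filter_subset_le_mul {B F : Finset G} (hB : IsSumFree (B : Set G)) {M : ℝ}
    (hM : ∀ S ⊆ F \ B, IsSumFree (S : Set G) →
      (#(misSets (linkGraph S) {x ∈ B | x ∉ linkLoops S}) : ℝ) ≤ M) (hM0 : 0 ≤ M) :
    (#{A ∈ maxSumFree G | A ⊆ F} : ℝ) ≤ 2 ^ #(F \ B) * M := by
  have h1 : {A ∈ maxSumFree G | A ⊆ F} ⊆ {A ∈ maxSumFree G | A ⊆ B ∪ F \ B} :=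
    monotone_filter_right _ fun A _ hA ↦ hA.trans (by
      rw [union_sdiff_self_eq_union]; exact subset_union_right)
  have h2 := (card_le_card h1).trans (card_maxSumFree_filter_subset_le hB)
  have h3 := (Nat.cast_le (α := ℝ)).2 h2
  push_cast at h3
  refine h3.trans ((sum_le_card_nsmul _ _ M fun S hS ↦ ?_).trans ?_)
  · rw [mem_filter, mem_powerset] at hS
    exact hM S hS.1 hS.2
  · rw [nsmul_eq_mul]
    refine mul_le_mul_of_nonneg_right ?_ hM0
    have := card_filter_le (F \ B).powerset fun S : Finset G ↦ IsSumFree (S : Set G)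
    rw [card_powerset] at this
    exact_mod_cast this

lemma card_maxSumFree_filter_subset_le_rpow (hodd : Odd (Fintype.card G))
    (hG : Fintype.card G = 5 * n) {B F : Finset G} (hB : IsSumFree (B : Set G)) :
    (#{A ∈ maxSumFree G | A ⊆ F} : ℝ) ≤ 2 ^ #(F \ B) * 2 ^ (0.9995 * n + 1729 : ℝ) := by
  by_cases hd : 37 * Fintype.card G < 100 * #B
  · obtain ⟨φ, hφ⟩ := exists_hom_of_large_sumFree hodd hB hd
    obtain ⟨x, hx⟩ : B.Nonempty := card_pos.1 (by omega)
    have hn := card_fiber_of_eq_one_or_four hG (mem_outerClasses.1 (hφ hx))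
    have h2 : Function.Injective fun x : G ↦ x + x := by
      intro x y hxy
      have h : (2 : ℕ).Coprime (Nat.card G) := by
        rw [Nat.card_eq_fintype_card]; exact Nat.coprime_two_left.2 hodd
      refine (nsmulCoprime h.symm).injective ?_
      simpa [two_nsmul] using hxy
    refine (card_maxSumFree_filter_subset_le_mul (isSumFree_outerClasses (φ := φ))
      (fun S hSF hS ↦ card_misSets_link_le h2 hn hS fun s hs ↦ (mem_sdiff.1 (hSF hs)).2)
      (by positivity)).trans ?_
    gcongr
    norm_num
  · refine card_maxSumFree_filter_subset_le_mul hB (fun S _ _ ↦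
      (card_misSets_le_two_rpow _).trans ?_) (by positivity)
    refine Real.rpow_le_rpow_of_exponent_le (by norm_num) ?_
    have h1 : #{x ∈ B | x ∉ linkLoops S} ≤ #B := card_filter_le _ _
    have h2 : 100 * #{x ∈ B | x ∉ linkLoops S} ≤ 185 * n := by omega
    have h3 : (100 * #{x ∈ B | x ∉ linkLoops S} : ℝ) ≤ 185 * n := by exact_mod_cast h2
    have : (0 : ℝ) ≤ n := by positivity
    norm_num
    linarith

lemma two_mul_card_le_sumFreeMu (H : Type*) [AddCommGroup H] [Fintype H] :
    2 * Fintype.card H ≤ sumFreeMu (ZMod 5 × H) := by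
  have hcard : Fintype.card (ZMod 5 × H) = 5 * Fintype.card H := by
    rw [Fintype.card_prod, ZMod.card]
  refine le_csSup ⟨Nat.card (ZMod 5 × H), ?_⟩
    ⟨outerClasses (AddMonoidHom.fst (ZMod 5) H), isSumFree_outerClasses, ?_⟩
  · rintro k ⟨A, -, rfl⟩
    exact Set.ncard_le_card A
  · rw [Set.ncard_coe_finset]
    exact card_outerClasses (card_fiber_of_eq_one_or_four hcard (x := (1, 0)) (Or.inl rfl))

lemma exists_fMaxSF_le : ∃ n₀ : ℕ, ∀ (G : Type*) [AddCommGroup G] [Fintype G] (n : ℕ),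
    Odd (Fintype.card G) → Fintype.card G = 5 * n → n₀ ≤ Fintype.card G →
      (fMaxSF G : ℝ) ≤ 2 ^ (0.9998 * n : ℝ) := by
  set ε : ℝ := 1 / 100000 with hε
  have hε0 : 0 < ε := by norm_num [hε]
  set δ : ℝ := SimpleGraph.triangleRemovalBound (ε / 27) with hδ
  have hδ0 : 0 < δ := SimpleGraph.triangleRemovalBound_pos (by positivity)
  obtain ⟨N₀, hN₀⟩ := exists_sumFree_containers hε0 hδ0
  refine ⟨max N₀ (5 * 8645000), fun G _ _ n hodd hG hN ↦ ?_⟩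
  rw [max_le_iff] at hN
  obtain ⟨𝓕, hc, hs, hA⟩ := hN₀ G hN.1
  have hn : (8645000 : ℝ) ≤ n := by
    have : 8645000 ≤ n := by omega
    exact_mod_cast this
  have hcover : maxSumFree G ⊆ 𝓕.biUnion fun F ↦ {A ∈ maxSumFree G | A ⊆ F} := by
    intro A hAmax
    obtain ⟨F, hF, hAF⟩ := hA A (mem_maxSumFree.1 hAmax).1
    exact mem_biUnion.2 ⟨F, hF, mem_filter.2 ⟨hAmax, hAF⟩⟩
  have hF : ∀ F ∈ 𝓕, (#{A ∈ maxSumFree G | A ⊆ F} : ℝ) ≤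
      2 ^ (ε * (5 * n)) * 2 ^ (0.9995 * n + 1729 : ℝ) := by
    intro F hF
    obtain ⟨B, -, hB, hFB⟩ := exists_sumFree_subset_of_card_schurPairs_lt (F := F) (ε := ε) (by
      have h1 := hs F hF
      have h2 : (0 : ℝ) < (Fintype.card G : ℝ) ^ 2 := by
        have : 0 < Fintype.card G := Fintype.card_pos
        positivity
      nlinarith [mul_pos hδ0 h2])
    refine (card_maxSumFree_filter_subset_le_rpow hodd hG hB).trans ?_
    refine mul_le_mul_of_nonneg_right ?_ (by positivity)
    rw [← Real.rpow_natCast]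
    refine Real.rpow_le_rpow_of_exponent_le (by norm_num) ?_
    rw [hG] at hFB
    exact_mod_cast hFB
  have h1 : (#(maxSumFree G) : ℝ) ≤ ∑ F ∈ 𝓕, (#{A ∈ maxSumFree G | A ⊆ F} : ℝ) := by
    exact_mod_cast (card_le_card hcover).trans card_biUnion_le
  rw [fMaxSF_eq_card]
  refine h1.trans ((sum_le_card_nsmul _ _ _ hF).trans ?_)
  rw [nsmul_eq_mul]
  refine (mul_le_mul_of_nonneg_right hc (by positivity)).trans ?_
  rw [← Real.rpow_add (by norm_num), ← Real.rpow_add (by norm_num)]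
  refine Real.rpow_le_rpow_of_exponent_le (by norm_num) ?_
  rw [hG]
  push_cast
  rw [hε]
  norm_num
  linarith

end Assembly

end

theorem few_maximal_sumfree_sets_Z5_times_odd :
    ∃ c : ℝ, c > 0 ∧ ∃ n₀ : ℕ,
      ∀ (H : Type) [AddCommGroup H] [Fintype H],
        Odd (Fintype.card H) → 5 * Fintype.card H ≥ n₀ →
        (fMaxSF (ZMod 5 × H) : ℝ) ≤ 2 ^ ((1 / 2 - c) * sumFreeMu (ZMod 5 × H)) := by
  obtain ⟨n₀, hn₀⟩ := exists_fMaxSF_le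
  refine ⟨1 / 10000, by norm_num, n₀, fun H _ _ hodd hn ↦ ?_⟩
  have hcard : Fintype.card (ZMod 5 × H) = 5 * Fintype.card H := by
    rw [Fintype.card_prod, ZMod.card]
  refine (hn₀ (ZMod 5 × H) (Fintype.card H) (by rw [hcard]; exact Odd.mul (by decide) hodd) hcard
    (by rwa [hcard])).trans ?_
  refine Real.rpow_le_rpow_of_exponent_le (by norm_num) ?_
  have : (2 * Fintype.card H : ℝ) ≤ sumFreeMu (ZMod 5 × H) := by
    exact_mod_cast two_mul_card_le_sumFreeMu H
  norm_num
  linarith
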